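/- Let I belong to class Q and let ‖·‖_Y be an r.i. norm. Then there exists an r.i. norm ‖·‖_X such that Y is the optimal target space for X under H_I if and only if T_I is bounded on Y', i.e. there exists C > 0 with ‖T_I f‖_{Y'} ≤ C·‖f‖_{Y'} for all f ∈ M_+(0,1). Moreover, in that case there exist c₁, c₂ > 0 such that for all f ∈ M_+(0,1): c₁·‖f‖_{X_Y} ≤ ‖ t ↦ ∫_t^1 f^*(s)/I(s) ds ‖_Y ≤ c₂·‖f‖_{X_Y}, where ‖f‖_{X_Y} = sup{ ‖H_I h‖_Y : h ∈ M_+(0,1), h^* = f^* } is the optimal domain norm for Y under H_I. -/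

import Mathlib

open MeasureTheory Set Filter
open scoped ENNReal

noncomputable section

/-- The nonincreasing rearrangement of `f` over `(0,1)`. -/
def rearr (f : ℝ → ℝ≥0∞) (t : ℝ) : ℝ≥0∞ :=
  sInf {l : ℝ≥0∞ | volume {s ∈ Set.Ioo (0:ℝ) 1 | l < f s} ≤ ENNReal.ofReal t}

/-- The maximal nonincreasing rearrangement `f^{**}(t) = (1/t) ∫_0^t f^*(s) ds`. -/
def dstar (f : ℝ → ℝ≥0∞) (t : ℝ) : ℝ≥0∞ :=
  (ENNReal.ofReal t)⁻¹ * ∫⁻ s in Set.Ioo (0:ℝ) t, rearr f s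

/-- The `L¹(0,1)` norm. -/
def lOne (f : ℝ → ℝ≥0∞) : ℝ≥0∞ := ∫⁻ t in Set.Ioo (0:ℝ) 1, f t

/-- The norm of the Marcinkiewicz-type space `m_I`. -/
def mNorm (I : ℝ → ℝ) (f : ℝ → ℝ≥0∞) : ℝ≥0∞ :=
  ⨆ t ∈ Set.Ioo (0:ℝ) 1, ENNReal.ofReal (I t) * rearr f t

/-- The norm of `m_Ĩ` where `Ĩ(t) = t / I(t)`. -/
def mNormTilde (I : ℝ → ℝ) (f : ℝ → ℝ≥0∞) : ℝ≥0∞ :=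
  ⨆ t ∈ Set.Ioo (0:ℝ) 1, ENNReal.ofReal (t / I t) * rearr f t

/-- The supremum operator `S_I f(t) = (1/I(t)) sup_{0<s≤t} I(s) f^*(s)`. -/
def SI (I : ℝ → ℝ) (f : ℝ → ℝ≥0∞) : ℝ → ℝ≥0∞ := fun t =>
  (ENNReal.ofReal (I t))⁻¹ * ⨆ s ∈ Set.Ioc (0:ℝ) t, ENNReal.ofReal (I s) * rearr f s

/-- The supremum operator `T_I f(t) = (I(t)/t) sup_{t≤s<1} (s/I(s)) f^*(s)`. -/
def TI (I : ℝ → ℝ) (f : ℝ → ℝ≥0∞) : ℝ → ℝ≥0∞ := fun t =>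
  ENNReal.ofReal (I t / t) * ⨆ s ∈ Set.Ico t 1, ENNReal.ofReal (s / I s) * rearr f s

/-- `H_I f(t) = ∫_t^1 f(s)/I(s) ds`. -/
def HI (I : ℝ → ℝ) (f : ℝ → ℝ≥0∞) : ℝ → ℝ≥0∞ := fun t =>
  ∫⁻ s in Set.Ioo t 1, f s / ENNReal.ofReal (I s)

/-- `R_I f(t) = (1/I(t)) ∫_0^t f(s) ds`. -/
def RI (I : ℝ → ℝ) (f : ℝ → ℝ≥0∞) : ℝ → ℝ≥0∞ := fun t =>
  (ENNReal.ofReal (I t))⁻¹ * ∫⁻ s in Set.Ioo (0:ℝ) t, f s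

/-- `I : (0,1) → (0,1)` is quasiconcave: a nondecreasing bijection of `(0,1)` onto `(0,1)`
with `I(t)/t` nonincreasing, `I(0+) = 0` and `I(1-) = 1`. -/
def Quasiconcave (I : ℝ → ℝ) : Prop :=
  Set.BijOn I (Set.Ioo 0 1) (Set.Ioo 0 1) ∧
  MonotoneOn I (Set.Ioo 0 1) ∧
  AntitoneOn (fun t => I t / t) (Set.Ioo 0 1) ∧
  Tendsto I (nhdsWithin 0 (Set.Ioo 0 1)) (nhds 0) ∧
  Tendsto I (nhdsWithin 1 (Set.Ioo 0 1)) (nhds 1)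

/-- Condition (★): `∫_0^t I(s)/s ds ≲ I(t)`. -/
def StarCond (I : ℝ → ℝ) : Prop :=
  ∃ C : ℝ, 0 < C ∧ ∀ t ∈ Set.Ioo (0:ℝ) 1,
    ∫⁻ s in Set.Ioo (0:ℝ) t, ENNReal.ofReal (I s / s) ≤ ENNReal.ofReal (C * I t)

/-- The average property: `∫_0^t ds/I(s) ≲ t/I(t)`. -/
def AvgProp (I : ℝ → ℝ) : Prop :=
  ∃ C : ℝ, 0 < C ∧ ∀ t ∈ Set.Ioo (0:ℝ) 1,
    ∫⁻ s in Set.Ioo (0:ℝ) t, ENNReal.ofReal (1 / I s) ≤ ENNReal.ofReal (C * (t / I t))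

/-- The condition `∫_t^1 I(s)/s² ds ≲ (1/t) ∫_0^t I(s)/s ds`. -/
def MaxCond (I : ℝ → ℝ) : Prop :=
  ∃ C : ℝ, 0 < C ∧ ∀ t ∈ Set.Ioo (0:ℝ) 1,
    ∫⁻ s in Set.Ioo t 1, ENNReal.ofReal (I s / s ^ 2) ≤
      ENNReal.ofReal (C / t) * ∫⁻ s in Set.Ioo (0:ℝ) t, ENNReal.ofReal (I s / s)

/-- The class `𝒬` of quasiconcave functions. -/
def ClassQ (I : ℝ → ℝ) : Prop :=
  Quasiconcave I ∧ StarCond I ∧ AvgProp I ∧ MaxCond I ∧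
  ∃ c d : ℝ,
    IsLUB {l : ℝ | 0 ≤ l ∧ ∀ t ∈ Set.Ioo (0:ℝ) 1,
      ENNReal.ofReal (l * (I t / t ^ 2 - 1)) ≤
        ∫⁻ s in Set.Ioo t 1, ENNReal.ofReal (I s / s ^ 3)} c ∧
    IsLeast {e : ℝ | 0 < e ∧ ∀ t ∈ Set.Ioo (0:ℝ) 1,
      ∫⁻ s in Set.Ioo t 1, ENNReal.ofReal (I s / s ^ 2) ≤
        ENNReal.ofReal (e * (I t / t))} d ∧
    (1 - c) * d ≤ c

/-- The `Δ₂` condition: `I(2t) ≤ C I(t)` for `t ∈ (0,1/2)`. -/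
def Delta2 (I : ℝ → ℝ) : Prop :=
  ∃ C : ℝ, 0 < C ∧ ∀ t ∈ Set.Ioo (0:ℝ) (1/2), I (2 * t) ≤ C * I t

/-- A rearrangement-invariant Banach function norm on `M₊(0,1)`. -/
def IsRiNorm (ρ : (ℝ → ℝ≥0∞) → ℝ≥0∞) : Prop :=
  (∀ f : ℝ → ℝ≥0∞, Measurable f →
      (ρ f = 0 ↔ f =ᵐ[volume.restrict (Set.Ioo (0:ℝ) 1)] 0)) ∧
  (∀ f : ℝ → ℝ≥0∞, Measurable f → ∀ a : ℝ, 0 ≤ a →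
      ρ (fun t => ENNReal.ofReal a * f t) = ENNReal.ofReal a * ρ f) ∧
  (∀ f g : ℝ → ℝ≥0∞, Measurable f → Measurable g →
      ρ (fun t => f t + g t) ≤ ρ f + ρ g) ∧
  (∀ f g : ℝ → ℝ≥0∞, Measurable f → Measurable g →
      (∀ᵐ t ∂(volume.restrict (Set.Ioo (0:ℝ) 1)), f t ≤ g t) → ρ f ≤ ρ g) ∧
  (∀ (fn : ℕ → ℝ → ℝ≥0∞) (f : ℝ → ℝ≥0∞), (∀ n, Measurable (fn n)) → Measurable f →
      (∀ᵐ t ∂(volume.restrict (Set.Ioo (0:ℝ) 1)), Monotone (fun n => fn n t)) →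
      (∀ᵐ t ∂(volume.restrict (Set.Ioo (0:ℝ) 1)), (⨆ n, fn n t) = f t) →
      (⨆ n, ρ (fn n)) = ρ f) ∧
  (ρ (fun _ => 1) < ⊤) ∧
  (∃ c : ℝ, 0 < c ∧ ∀ f : ℝ → ℝ≥0∞, Measurable f →
      ∫⁻ t in Set.Ioo (0:ℝ) 1, f t ≤ ENNReal.ofReal c * ρ f) ∧
  (∀ f : ℝ → ℝ≥0∞, Measurable f → ρ f = ρ (rearr f))

/-- The associate norm `ρ'`. -/
def assoc (ρ : (ℝ → ℝ≥0∞) → ℝ≥0∞) (f : ℝ → ℝ≥0∞) : ℝ≥0∞ :=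
  ⨆ (g : ℝ → ℝ≥0∞) (_ : Measurable g ∧ ρ g ≤ 1),
    ∫⁻ t in Set.Ioo (0:ℝ) 1, f t * g t

/-- The optimal target norm `‖f‖_{Y_X}` of the r.i. norm `ρ = ‖·‖_X` under `H_I`. -/
def optTargetNorm (I : ℝ → ℝ) (ρ : (ℝ → ℝ≥0∞) → ℝ≥0∞) (f : ℝ → ℝ≥0∞) : ℝ≥0∞ :=
  ⨆ (g : ℝ → ℝ≥0∞) (_ : Measurable g ∧ assoc ρ (RI I (rearr g)) ≤ 1),
    ∫⁻ t in Set.Ioo (0:ℝ) 1, rearr f t * rearr g t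

/-- The optimal domain norm `‖f‖_{X_Y} = sup_{h ∼ f} ‖H_I h‖_Y`. -/
def optDomainNorm (I : ℝ → ℝ) (ρY : (ℝ → ℝ≥0∞) → ℝ≥0∞) (f : ℝ → ℝ≥0∞) : ℝ≥0∞ :=
  ⨆ (h : ℝ → ℝ≥0∞)
    (_ : Measurable h ∧ ∀ t ∈ Set.Ioo (0:ℝ) 1, rearr h t = rearr f t),
      ρY (HI I h)

/-- `H_I : X → Y` boundedly. -/
def HIBounded (I : ℝ → ℝ) (ρX ρY : (ℝ → ℝ≥0∞) → ℝ≥0∞) : Prop :=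
  ∃ C : ℝ, 0 < C ∧ ∀ f : ℝ → ℝ≥0∞, Measurable f →
    ρY (HI I f) ≤ ENNReal.ofReal C * ρX f

/-- `X` is the optimal domain space for `Y` under `H_I`. -/
def IsOptimalDomain (I : ℝ → ℝ) (ρX ρY : (ℝ → ℝ≥0∞) → ℝ≥0∞) : Prop :=
  HIBounded I ρX ρY ∧
  ∀ ρZ : (ℝ → ℝ≥0∞) → ℝ≥0∞, IsRiNorm ρZ → HIBounded I ρZ ρY →
    ∃ C : ℝ, 0 < C ∧ ∀ f : ℝ → ℝ≥0∞, Measurable f →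
      ρX f ≤ ENNReal.ofReal C * ρZ f

/-- `Y` is the optimal target space for `X` under `H_I`. -/
def IsOptimalTarget (I : ℝ → ℝ) (ρX ρY : (ℝ → ℝ≥0∞) → ℝ≥0∞) : Prop :=
  HIBounded I ρX ρY ∧
  ∀ ρZ : (ℝ → ℝ≥0∞) → ℝ≥0∞, IsRiNorm ρZ → HIBounded I ρX ρZ →
    ∃ C : ℝ, 0 < C ∧ ∀ f : ℝ → ℝ≥0∞, Measurable f →
      ρZ f ≤ ENNReal.ofReal C * ρY f

/-- Lebesgue measure on `(0,1)`. -/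
noncomputable abbrev mu01 : Measure ℝ := volume.restrict (Set.Ioo (0:ℝ) 1)

theorem rearr_le_iff (f : ℝ → ℝ≥0∞) (t : ℝ) (l : ℝ≥0∞) :
    rearr f t ≤ l ↔ volume {s ∈ Set.Ioo (0:ℝ) 1 | l < f s} ≤ ENNReal.ofReal t := by
  constructor
  · intro h
    rcases eq_or_ne l ⊤ with rfl | hl
    · have : {s ∈ Set.Ioo (0:ℝ) 1 | (⊤:ℝ≥0∞) < f s} = ∅ := by ext s; simp
      rw [this]; simp
    · obtain ⟨u, hu, hlu, hut⟩ := exists_seq_strictAnti_tendsto' (lt_top_iff_ne_top.2 hl)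
      have hU : {s ∈ Set.Ioo (0:ℝ) 1 | l < f s} = ⋃ n, {s ∈ Set.Ioo (0:ℝ) 1 | u n < f s} := by
        ext s
        simp only [mem_ofPred_eq, mem_iUnion]
        constructor
        · rintro ⟨h1, h2⟩
          obtain ⟨n, hn⟩ := (hut.eventually (gt_mem_nhds h2)).exists
          exact ⟨n, h1, hn⟩
        · rintro ⟨n, h1, h2⟩
          exact ⟨h1, (hlu n).1.trans h2⟩
      rw [hU, Monotone.measure_iUnion]
      · refine iSup_le fun n => ?_
        have : rearr f t < u n := lt_of_le_of_lt h (hlu n).1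
        obtain ⟨a, ha, hau⟩ := sInf_lt_iff.1 this
        refine le_trans (measure_mono ?_) ha
        rintro s ⟨h1, h2⟩
        exact ⟨h1, hau.trans h2⟩
      · intro m n hmn s hs
        exact ⟨hs.1, (hu.antitone hmn).trans_lt hs.2⟩
  · intro h
    exact sInf_le h

theorem lt_rearr_iff (f : ℝ → ℝ≥0∞) (t : ℝ) (l : ℝ≥0∞) :
    l < rearr f t ↔ ENNReal.ofReal t < volume {s ∈ Set.Ioo (0:ℝ) 1 | l < f s} := by
  rw [← not_le, rearr_le_iff, not_le]

theorem rearr_antitone (f : ℝ → ℝ≥0∞) : Antitone (rearr f) := by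
  intro s t hst
  rw [rearr_le_iff]
  exact ((rearr_le_iff f s _).1 le_rfl).trans (ENNReal.ofReal_le_ofReal hst)

theorem rearr_meas (f : ℝ → ℝ≥0∞) : Measurable (rearr f) := (rearr_antitone f).measurable

theorem dist_le_one (f : ℝ → ℝ≥0∞) (l : ℝ≥0∞) :
    volume {s ∈ Set.Ioo (0:ℝ) 1 | l < f s} ≤ 1 := by
  calc _ ≤ volume (Set.Ioo (0:ℝ) 1) := measure_mono fun s hs => hs.1
    _ = 1 := by simp

theorem vol_initial (d : ℝ≥0∞) (hd : d ≤ 1) :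
    volume {t ∈ Set.Ioo (0:ℝ) 1 | ENNReal.ofReal t < d} = d := by
  have hT : d ≠ ⊤ := ne_top_of_le_ne_top ENNReal.one_ne_top hd
  have : {t ∈ Set.Ioo (0:ℝ) 1 | ENNReal.ofReal t < d} = Ioo 0 d.toReal := by
    ext t
    have h1 : d.toReal ≤ 1 := by simpa using ENNReal.toReal_mono ENNReal.one_ne_top hd
    constructor
    · rintro ⟨h, h2⟩
      exact ⟨h.1, (ENNReal.ofReal_lt_iff_lt_toReal h.1.le hT).1 h2⟩
    · rintro ⟨h, h2⟩
      exact ⟨⟨h, h2.trans_le h1⟩, (ENNReal.ofReal_lt_iff_lt_toReal h.le hT).2 h2⟩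
  rw [this]; simp [hT]

theorem dist_rearr (f : ℝ → ℝ≥0∞) (l : ℝ≥0∞) :
    volume {s ∈ Set.Ioo (0:ℝ) 1 | l < rearr f s} = volume {s ∈ Set.Ioo (0:ℝ) 1 | l < f s} := by
  simp_rw [lt_rearr_iff]
  exact vol_initial _ (dist_le_one f l)

theorem rearr_congr_dist {f g : ℝ → ℝ≥0∞}
    (h : ∀ l, volume {s ∈ Set.Ioo (0:ℝ) 1 | l < f s} = volume {s ∈ Set.Ioo (0:ℝ) 1 | l < g s}) :
    rearr f = rearr g := by
  ext t; unfold rearr; simp_rw [h]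

theorem rearr_rearr (f : ℝ → ℝ≥0∞) : rearr (rearr f) = rearr f :=
  rearr_congr_dist (dist_rearr f)

theorem set_eq_restrict (f : ℝ → ℝ≥0∞) (hf : Measurable f) (l : ℝ≥0∞) :
    volume {s ∈ Set.Ioo (0:ℝ) 1 | l < f s} = mu01 {s | l < f s} := by
  rw [Measure.restrict_apply (measurableSet_lt measurable_const hf)]
  congr 1; ext s; simp [and_comm]

theorem rearr_mono {f g : ℝ → ℝ≥0∞} (hf : Measurable f) (hg : Measurable g)
    (h : ∀ᵐ t ∂mu01, f t ≤ g t) (t : ℝ) : rearr f t ≤ rearr g t := by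
  rw [rearr_le_iff]
  refine le_trans ?_ ((rearr_le_iff g t _).1 le_rfl)
  rw [set_eq_restrict f hf, set_eq_restrict g hg]
  refine measure_mono_ae ?_
  filter_upwards [h] with s hs h2
  exact lt_of_lt_of_le h2 hs

theorem rearr_le_self {F : ℝ → ℝ≥0∞} (hF : AntitoneOn F (Ioo 0 1)) {t : ℝ} (ht : t ∈ Ioo (0:ℝ) 1) :
    rearr F t ≤ F t := by
  rw [rearr_le_iff]
  calc _ ≤ volume (Ioo 0 t) := by
        refine measure_mono fun s hs => ⟨hs.1.1, ?_⟩
        by_contra hc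
        exact absurd (hF ht hs.1 (not_lt.1 hc)) (not_le.2 hs.2)
    _ = _ := by simp

theorem rearr_const_mul (f : ℝ → ℝ≥0∞) (a : ℝ) (ha : 0 ≤ a) (t : ℝ) :
    rearr (fun t => ENNReal.ofReal a * f t) t = ENNReal.ofReal a * rearr f t := by
  rcases ha.eq_or_lt with rfl | ha
  · simp only [ENNReal.ofReal_zero, zero_mul]
    refine le_antisymm ?_ bot_le
    rw [rearr_le_iff]; simp
  · have h0 : ENNReal.ofReal a ≠ 0 := by simpa using ha
    refine eq_of_forall_ge_iff fun l => ?_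
    rw [ENNReal.mul_le_iff_le_inv h0 ENNReal.ofReal_ne_top, rearr_le_iff, rearr_le_iff]
    have : ∀ s, l < ENNReal.ofReal a * f s ↔ (ENNReal.ofReal a)⁻¹ * l < f s := by
      intro s
      rw [← not_le, ENNReal.mul_le_iff_le_inv h0 ENNReal.ofReal_ne_top, not_le]
    simp_rw [this]

theorem rearr_iSup {fn : ℕ → ℝ → ℝ≥0∞} {f : ℝ → ℝ≥0∞} (hfn : ∀ n, Measurable (fn n))
    (hf : Measurable f) (hm : ∀ᵐ t ∂mu01, Monotone (fun n => fn n t))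
    (hs : ∀ᵐ t ∂mu01, (⨆ n, fn n t) = f t) (t : ℝ) : (⨆ n, rearr (fn n) t) = rearr f t := by
  refine eq_of_forall_ge_iff fun l => ?_
  rw [iSup_le_iff]
  simp_rw [rearr_le_iff]
  rw [← iSup_le_iff]
  suffices h : (⨆ n, volume {s ∈ Set.Ioo (0:ℝ) 1 | l < fn n s}) =
      volume {s ∈ Set.Ioo (0:ℝ) 1 | l < f s} by rw [h]
  simp_rw [set_eq_restrict _ (hfn _), set_eq_restrict f hf]
  have e : ∀ g : ℝ → ℝ≥0∞, Measurable g →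
      mu01 {s | l < g s} = ∫⁻ s, {s | l < g s}.indicator (fun _ => 1) s ∂mu01 := by
    intro g hg
    rw [lintegral_indicator (measurableSet_lt measurable_const hg)]; simp
  simp_rw [e _ (hfn _), e f hf]
  rw [← lintegral_iSup']
  · refine lintegral_congr_ae ?_
    filter_upwards [hs] with s hs
    have hmem : l < f s ↔ ∃ n, l < fn n s := by
      rw [← hs, lt_iSup_iff]
    simp only [Set.indicator_apply]
    simp only [mem_ofPred_eq]
    by_cases h : ∃ n, l < fn n s
    · rw [if_pos (hmem.2 h)]
      refine le_antisymm (iSup_le fun n => by split_ifs <;> simp) ?_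
      obtain ⟨n, hn⟩ := h
      exact le_iSup_of_le n (by simp [hn])
    · rw [if_neg (hmem.not.2 h)]; push Not at h
      simp [fun n => not_lt.2 (h n)]
  · exact fun n => (measurable_const.indicator (measurableSet_lt measurable_const (hfn n))).aemeasurable
  · filter_upwards [hm] with s hs m n hmn
    simp only [Set.indicator_apply, mem_ofPred_eq]
    split_ifs with h1 h2
    · rfl
    · exact absurd (h1.trans_le (hs hmn)) h2
    · simp
    · rfl

/-- layer cake for one value -/
theorem layer (a : ℝ≥0∞) : volume {l ∈ Ioi (0:ℝ) | ENNReal.ofReal l < a} = a := by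
  rcases eq_or_ne a ⊤ with rfl | ha
  · have : {l ∈ Ioi (0:ℝ) | ENNReal.ofReal l < ⊤} = Ioi 0 := by ext; simp
    rw [this]; simp
  · have : {l ∈ Ioi (0:ℝ) | ENNReal.ofReal l < a} = Ioo 0 a.toReal := by
      ext l
      constructor
      · rintro ⟨h, h2⟩
        exact ⟨h, (ENNReal.ofReal_lt_iff_lt_toReal (le_of_lt h) ha).1 h2⟩
      · rintro ⟨h, h2⟩
        exact ⟨h, (ENNReal.ofReal_lt_iff_lt_toReal h.le ha).2 h2⟩
    rw [this]; simp [ha]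

theorem layer_int (a : ℝ≥0∞) :
    ∫⁻ l in Ioi (0:ℝ), (if ENNReal.ofReal l < a then 1 else 0 : ℝ≥0∞) = a := by
  have hm : MeasurableSet {l : ℝ | ENNReal.ofReal l < a} :=
    measurableSet_lt ENNReal.measurable_ofReal measurable_const
  have : (fun l : ℝ => (if ENNReal.ofReal l < a then 1 else 0 : ℝ≥0∞)) =
      {l : ℝ | ENNReal.ofReal l < a}.indicator (fun _ => 1) := by
    ext l; simp [Set.indicator_apply]
  rw [this, lintegral_indicator hm, Measure.restrict_restrict hm]
  simp only [lintegral_const, one_mul, Measure.restrict_apply_univ]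
  conv_rhs => rw [← layer a]
  congr 1; ext; simp [and_comm]

theorem meas_level {f : ℝ → ℝ≥0∞} (hf : Measurable f) :
    MeasurableSet {p : ℝ × ℝ | ENNReal.ofReal p.1 < f p.2} :=
  measurableSet_lt (ENNReal.measurable_ofReal.comp measurable_fst) (hf.comp measurable_snd)

/-- `∫ f g = ∫_λ ∫_{f>λ} g`. -/
theorem layer_mul {f g : ℝ → ℝ≥0∞} (hf : Measurable f) (hg : Measurable g) :
    ∫⁻ t, f t * g t ∂mu01 = ∫⁻ l in Ioi (0:ℝ), ∫⁻ t in {t | ENNReal.ofReal l < f t}, g t ∂mu01 := by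
  have h1 : ∀ t, f t * g t = ∫⁻ l in Ioi (0:ℝ), (if ENNReal.ofReal l < f t then 1 else 0 : ℝ≥0∞) * g t := by
    intro t
    rw [lintegral_mul_const, layer_int]
    exact Measurable.ite (measurableSet_lt ENNReal.measurable_ofReal measurable_const) measurable_const measurable_const
  simp_rw [h1]
  rw [lintegral_lintegral_swap]
  · refine lintegral_congr fun l => ?_
    rw [← lintegral_indicator (measurableSet_lt measurable_const hf)]
    refine lintegral_congr fun t => ?_
    simp [Set.indicator_apply]
  · refine Measurable.aemeasurable ?_
    refine Measurable.mul ?_ (hg.comp measurable_fst)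
    exact Measurable.ite (measurableSet_lt (ENNReal.measurable_ofReal.comp measurable_snd)
      (hf.comp measurable_fst)) measurable_const measurable_const

/-- ∫_E g ≤ ∫_0^{|E|} g^*. -/
theorem hl_set {g : ℝ → ℝ≥0∞} (hg : Measurable g) {E F : Set ℝ} (hE : MeasurableSet E) (hF : MeasurableSet F)
    (hFi : ∀ x ∈ Ioo (0:ℝ) 1, ENNReal.ofReal x < mu01 E → x ∈ F) :
    ∫⁻ t in E, g t ∂mu01 ≤ ∫⁻ t in F, rearr g t ∂mu01 := by
  have key : ∀ (k : ℝ → ℝ≥0∞) (G : Set ℝ), Measurable k → MeasurableSet G →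
      ∫⁻ t in G, k t ∂mu01 = ∫⁻ l in Ioi (0:ℝ), mu01 ({t | ENNReal.ofReal l < k t} ∩ G) := by
    intro k G hk hG
    have := layer_mul hk (measurable_const.indicator hG : Measurable (G.indicator fun _ => (1:ℝ≥0∞)))
    have e : ∀ t, k t * (G.indicator (fun _ => 1) t) = G.indicator k t := by
      intro t; by_cases h : t ∈ G <;> simp [h]
    simp_rw [e] at this
    rw [lintegral_indicator hG] at this
    rw [this]
    refine lintegral_congr fun l => ?_
    rw [lintegral_indicator hG, Measure.restrict_restrict hG]
    simp [inter_comm]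
  rw [key g E hg hE, key _ F (rearr_meas g) hF]
  refine lintegral_mono fun l => ?_
  have hd : min (mu01 E) (mu01 {t | ENNReal.ofReal l < g t}) ≤ 1 := by
    refine (min_le_right _ _).trans ?_
    rw [← set_eq_restrict g hg]; exact dist_le_one _ _
  calc mu01 ({t | ENNReal.ofReal l < g t} ∩ E)
      ≤ min (mu01 E) (mu01 {t | ENNReal.ofReal l < g t}) :=
        le_min (measure_mono inter_subset_right) (measure_mono inter_subset_left)
    _ = volume {t ∈ Ioo (0:ℝ) 1 | ENNReal.ofReal t < min (mu01 E) (mu01 {t | ENNReal.ofReal l < g t})} :=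
        (vol_initial _ hd).symm
    _ ≤ _ := by
        rw [Measure.restrict_apply ((measurableSet_lt measurable_const (rearr_meas g)).inter hF)]
        refine measure_mono ?_
        rintro t ⟨h1, h2⟩
        rw [lt_min_iff, ← set_eq_restrict g hg] at h2
        exact ⟨⟨(lt_rearr_iff _ _ _).2 h2.2, hFi t h1 h2.1⟩, h1⟩

/-- Hardy–Littlewood. -/
theorem hardy_littlewood {f g : ℝ → ℝ≥0∞} (hf : Measurable f) (hg : Measurable g) :
    ∫⁻ t, f t * g t ∂mu01 ≤ ∫⁻ t, rearr f t * rearr g t ∂mu01 := by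
  rw [layer_mul hf hg, layer_mul (rearr_meas f) (rearr_meas g)]
  refine lintegral_mono fun l => ?_
  refine hl_set hg (measurableSet_lt measurable_const hf) (measurableSet_lt measurable_const (rearr_meas f)) ?_
  intro x hx h
  rw [← set_eq_restrict f hf] at h
  exact (lt_rearr_iff _ _ _).2 h

theorem hl_left {F g : ℝ → ℝ≥0∞} (hF : Measurable F) (hFa : AntitoneOn F (Ioo 0 1)) (hg : Measurable g) :
    ∫⁻ t, F t * g t ∂mu01 ≤ ∫⁻ t, F t * rearr g t ∂mu01 := by
  refine (hardy_littlewood hF hg).trans ?_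
  refine setLIntegral_mono' measurableSet_Ioo fun t ht => ?_
  gcongr
  exact rearr_le_self hFa ht

theorem int_rearr {f : ℝ → ℝ≥0∞} (hf : Measurable f) : ∫⁻ t, rearr f t ∂mu01 = ∫⁻ t, f t ∂mu01 := by
  have h1 := layer_mul hf (measurable_const : Measurable fun _ : ℝ => (1:ℝ≥0∞))
  have h2 := layer_mul (rearr_meas f) (measurable_const : Measurable fun _ : ℝ => (1:ℝ≥0∞))
  simp only [mul_one, lintegral_const, one_mul, Measure.restrict_apply_univ] at h1 h2
  rw [h1, h2]
  refine lintegral_congr fun l => ?_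
  rw [← set_eq_restrict _ (rearr_meas f), ← set_eq_restrict _ hf, dist_rearr]

theorem le_vol_ge (g : ℝ → ℝ≥0∞) (hg : Measurable g) {t : ℝ} (ht : t ∈ Ioo (0:ℝ) 1) :
    ENNReal.ofReal t ≤ volume {s ∈ Ioo (0:ℝ) 1 | rearr g t ≤ g s} := by
  rcases eq_or_ne (rearr g t) 0 with h0 | h0
  · have : {s ∈ Ioo (0:ℝ) 1 | rearr g t ≤ g s} = Ioo 0 1 := by ext s; simp [h0]
    rw [this]; simp [ht.2.le]
  · obtain ⟨u, hu, hlu, hut⟩ := exists_seq_strictMono_tendsto' (pos_iff_ne_zero.2 h0)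
    have hU : {s ∈ Ioo (0:ℝ) 1 | rearr g t ≤ g s} = ⋂ n, {s ∈ Ioo (0:ℝ) 1 | u n < g s} := by
      ext s
      simp only [mem_ofPred_eq, mem_iInter]
      constructor
      · rintro ⟨h1, h2⟩ n
        exact ⟨h1, (hlu n).2.trans_le h2⟩
      · intro h
        exact ⟨(h 0).1, le_of_tendsto' hut fun n => (h n).2.le⟩
    rw [hU, Antitone.measure_iInter]
    · refine le_iInf fun n => ?_
      exact ((lt_rearr_iff g t _).1 (hlu n).2).le
    · intro m n hmn s hs
      exact ⟨hs.1, (hu.monotone hmn).trans_lt hs.2⟩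
    · intro n
      exact (measurableSet_Ioo.inter (measurableSet_lt measurable_const hg)).nullMeasurableSet
    · exact ⟨0, ne_top_of_le_ne_top ENNReal.one_ne_top (dist_le_one g _)⟩

/-- predecessors of `x` in the order larger `g` first, ties broken by position -/
def predSet (g : ℝ → ℝ≥0∞) (x : ℝ) : Set ℝ :=
  {y | y ∈ Ioo (0:ℝ) 1 ∧ (g x < g y ∨ (g y = g x ∧ y < x))}

theorem predSet_le_one (g : ℝ → ℝ≥0∞) (x : ℝ) : volume (predSet g x) ≤ 1 := by
  calc _ ≤ volume (Set.Ioo (0:ℝ) 1) := measure_mono fun s hs => hs.1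
    _ = 1 := by simp

theorem exists_segment (g : ℝ → ℝ≥0∞) (hg : Measurable g) {t : ℝ} (ht : t ∈ Ioo (0:ℝ) 1) :
    ∃ E : Set ℝ, E ⊆ Ioo 0 1 ∧ volume E = ENNReal.ofReal t ∧
      (∀ x ∈ E, volume (predSet g x) ≤ ENNReal.ofReal t) ∧
      (∀ x ∈ Ioo (0:ℝ) 1, x ∉ E → ENNReal.ofReal t ≤ volume (predSet g x)) := by
  set lam := rearr g t with hlam
  set A : Set ℝ := {y | y ∈ Ioo (0:ℝ) 1 ∧ lam < g y} with hA
  set B : Set ℝ := {y | y ∈ Ioo (0:ℝ) 1 ∧ g y = lam} with hB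
  set S : ℝ → Set ℝ := fun a => A ∪ (B ∩ Iio a) with hS
  have hSsub : ∀ a, S a ⊆ Ioo 0 1 := by
    rintro a y (h | h)
    · exact h.1
    · exact h.1.1
  have hfin : ∀ a, volume (S a) ≠ ⊤ := fun a =>
    ne_top_of_le_ne_top (by simp) (measure_mono (hSsub a))
  have hlip : LipschitzWith 1 (fun a => (volume (S a)).toReal) := by
    refine LipschitzWith.of_le_add fun x y => ?_
    have h1 : volume (S x) ≤ volume (S y) + ENNReal.ofReal (dist x y) := by
      calc volume (S x) ≤ volume (S y ∪ Ico y x) := by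
            refine measure_mono ?_
            rintro z (h | ⟨h, h2⟩)
            · exact Or.inl (Or.inl h)
            · by_cases hz : z < y
              · exact Or.inl (Or.inr ⟨h, hz⟩)
              · exact Or.inr ⟨not_lt.1 hz, h2⟩
        _ ≤ volume (S y) + volume (Ico y x) := measure_union_le _ _
        _ ≤ _ := by
            gcongr
            rw [Real.volume_Ico, Real.dist_eq]
            exact ENNReal.ofReal_le_ofReal (le_abs_self _)
    have h2 := ENNReal.toReal_mono (by simp [hfin]) h1
    rwa [ENNReal.toReal_add (hfin y) ENNReal.ofReal_ne_top, ENNReal.toReal_ofReal dist_nonneg] at h2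
  have h0 : (volume (S 0)).toReal ≤ t := by
    refine ENNReal.toReal_le_of_le_ofReal ht.1.le ?_
    refine le_trans (measure_mono ?_) ((rearr_le_iff g t _).1 le_rfl)
    rintro z (h | ⟨h, h2⟩)
    · exact h
    · exact absurd h.1.1 (not_lt.2 (le_of_lt h2))
  have h1 : t ≤ (volume (S 1)).toReal := by
    rw [← ENNReal.ofReal_le_iff_le_toReal (hfin 1)]
    refine (le_vol_ge g hg ht).trans (measure_mono ?_)
    rintro z ⟨h, h2⟩
    rcases h2.eq_or_lt with h3 | h3
    · exact Or.inr ⟨⟨h, h3.symm⟩, h.2⟩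
    · exact Or.inl ⟨h, h3⟩
  obtain ⟨a, -, ha⟩ := intermediate_value_Icc zero_le_one hlip.continuous.continuousOn ⟨h0, h1⟩
  have hva : volume (S a) = ENNReal.ofReal t := by
    rw [← ha, ENNReal.ofReal_toReal (hfin a)]
  refine ⟨S a, hSsub a, hva, ?_, ?_⟩
  · intro x hx
    rw [← hva]
    refine measure_mono ?_
    rintro y ⟨hy, hy2⟩
    rcases hx with hx | ⟨hx, hxa⟩
    · left
      refine ⟨hy, ?_⟩
      rcases hy2 with h | h
      · exact hx.2.trans h
      · rw [h.1]; exact hx.2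
    · rcases hy2 with h | h
      · left; exact ⟨hy, by rw [← hx.2]; exact h⟩
      · right; exact ⟨⟨hy, h.1.trans hx.2⟩, h.2.trans hxa⟩
  · intro x hx hxE
    rw [← hva]
    refine measure_mono ?_
    have hxl : g x ≤ lam := by
      by_contra hc
      exact hxE (Or.inl ⟨hx, not_le.1 hc⟩)
    rintro y (hy | ⟨hy, hya⟩)
    · exact ⟨hy.1, Or.inl (hxl.trans_lt hy.2)⟩
    · refine ⟨hy.1, ?_⟩
      rcases hxl.eq_or_lt with h | h
      · right
        refine ⟨hy.2.trans h.symm, lt_of_lt_of_le hya ?_⟩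
        by_contra hc
        exact hxE (Or.inr ⟨⟨hx, h⟩, not_le.1 hc⟩)
      · left; rw [hy.2]; exact h

theorem exists_sigma (g : ℝ → ℝ≥0∞) (hg : Measurable g) :
    ∃ σ : ℝ → ℝ, MeasurePreserving σ mu01 mu01 ∧ ∀ x, rearr g (σ x) ≤ g x := by
  have hfin : ∀ x, volume (predSet g x) ≠ ⊤ := fun x =>
    ne_top_of_le_ne_top ENNReal.one_ne_top (predSet_le_one g x)
  have hm : Measurable (fun x => (volume (predSet g x)).toReal) := by
    refine Measurable.ennreal_toReal ?_
    have hs : MeasurableSet {p : ℝ × ℝ | p.2 ∈ Ioo (0:ℝ) 1 ∧ (g p.1 < g p.2 ∨ (g p.2 = g p.1 ∧ p.2 < p.1))} := by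
      refine (measurable_snd measurableSet_Ioo).inter (MeasurableSet.union ?_ (MeasurableSet.inter ?_ ?_))
      · exact measurableSet_lt (hg.comp measurable_fst) (hg.comp measurable_snd)
      · exact measurableSet_eq_fun (hg.comp measurable_snd) (hg.comp measurable_fst)
      · exact measurableSet_lt measurable_snd measurable_fst
    exact measurable_measure_prodMk_left hs
  refine ⟨fun x => (volume (predSet g x)).toReal, ⟨hm, ?_⟩, ?_⟩
  · have hup : ∀ t t' : ℝ, t < t' → t' ∈ Ioo (0:ℝ) 1 →
        mu01 {x | (volume (predSet g x)).toReal ≤ t} ≤ ENNReal.ofReal t' := by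
      intro t t' htt ht'
      obtain ⟨E, hE1, hE2, hE3, hE4⟩ := exists_segment g hg ht'
      rw [Measure.restrict_apply (measurableSet_le hm measurable_const), ← hE2]
      refine measure_mono ?_
      rintro x ⟨hx, hx1⟩
      by_contra hc
      have := hE4 x hx1 hc
      rw [ENNReal.ofReal_le_iff_le_toReal (hfin x)] at this
      have hx' : (volume (predSet g x)).toReal ≤ t := hx
      linarith
    have hzero : ∀ t : ℝ, t ≤ 0 → mu01 {x | (volume (predSet g x)).toReal ≤ t} = 0 := by
      intro t ht
      refine le_antisymm ?_ bot_le
      refine ENNReal.le_of_forall_pos_le_add fun ε hε _ => ?_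
      have hmin : min (ε:ℝ) (1/2) ∈ Ioo (0:ℝ) 1 :=
        ⟨lt_min hε (by norm_num), (min_le_right _ _).trans_lt (by norm_num)⟩
      refine (hup t (min ε (1/2)) (ht.trans_lt hmin.1) hmin).trans ?_
      rw [zero_add]
      calc _ ≤ ENNReal.ofReal ε := ENNReal.ofReal_le_ofReal (min_le_left _ _)
        _ = ε := by simp
    have hmid : ∀ t ∈ Ioo (0:ℝ) 1, mu01 {x | (volume (predSet g x)).toReal ≤ t} = ENNReal.ofReal t := by
      intro t ht
      apply le_antisymm
      · refine ENNReal.le_of_forall_pos_le_add fun ε hε _ => ?_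
        have hmin : min (t + ε:ℝ) ((t+1)/2) ∈ Ioo (0:ℝ) 1 := by
          refine ⟨lt_min ?_ ?_, (min_le_right _ _).trans_lt ?_⟩
          · have : (0:ℝ) < ε := hε
            linarith [ht.1]
          · linarith [ht.1]
          · linarith [ht.2]
        refine (hup t _ ?_ hmin).trans ?_
        · refine lt_min ?_ ?_
          · have : (0:ℝ) < ε := hε
            linarith
          · linarith [ht.2]
        · calc _ ≤ ENNReal.ofReal (t + ε) := ENNReal.ofReal_le_ofReal (min_le_left _ _)
            _ ≤ ENNReal.ofReal t + ENNReal.ofReal ε := ENNReal.ofReal_add_le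
            _ = _ := by simp
      · obtain ⟨E, hE1, hE2, hE3, hE4⟩ := exists_segment g hg ht
        rw [Measure.restrict_apply (measurableSet_le hm measurable_const), ← hE2]
        refine measure_mono fun x hx => ⟨?_, hE1 hx⟩
        exact ENNReal.toReal_le_of_le_ofReal ht.1.le (hE3 x hx)
    have : IsFiniteMeasure (Measure.map (fun x => (volume (predSet g x)).toReal) mu01) :=
      Measure.isFiniteMeasure_map _ _
    refine Measure.ext_of_Iic _ _ fun t => ?_
    rw [Measure.map_apply hm measurableSet_Iic]
    change mu01 {x | (volume (predSet g x)).toReal ≤ t} = _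
    rw [Measure.restrict_apply (measurableSet_Iic : MeasurableSet (Iic t))]
    rcases le_or_gt t 0 with h | h
    · rw [hzero t h]
      have : Iic t ∩ Ioo (0:ℝ) 1 = ∅ := by
        ext x; simp only [mem_inter_iff, mem_Iic, mem_Ioo, mem_empty_iff_false, iff_false]
        rintro ⟨h1, h2, h3⟩; linarith
      rw [this]; simp
    · rcases lt_or_ge t 1 with h1 | h1
      · rw [hmid t ⟨h, h1⟩]
        have : Iic t ∩ Ioo (0:ℝ) 1 = Ioc 0 t := by
          ext x; simp only [mem_inter_iff, mem_Iic, mem_Ioo, mem_Ioc]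
          constructor
          · rintro ⟨h1, h2, h3⟩; exact ⟨h2, h1⟩
          · rintro ⟨h2, h3⟩; exact ⟨h3, h2, h3.trans_lt h1⟩
        rw [this]; simp
      · have e1 : {x | (volume (predSet g x)).toReal ≤ t} = univ := by
          ext x; simp only [mem_ofPred_eq, mem_univ, iff_true]
          have := ENNReal.toReal_mono ENNReal.one_ne_top (predSet_le_one g x)
          simp at this; linarith
        have e2 : Iic t ∩ Ioo (0:ℝ) 1 = Ioo 0 1 := by
          ext x; simp only [mem_inter_iff, mem_Iic, mem_Ioo, and_iff_right_iff_imp]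
          rintro ⟨h2, h3⟩; linarith
        rw [e1, e2]; simp
  · intro x
    rw [rearr_le_iff, ENNReal.ofReal_toReal (hfin x)]
    exact measure_mono fun y hy => ⟨hy.1, Or.inl hy.2⟩

theorem rearr_comp {σ : ℝ → ℝ} (hσ : MeasurePreserving σ mu01 mu01) {w : ℝ → ℝ≥0∞} (hw : Measurable w) :
    rearr (fun x => w (σ x)) = rearr w := by
  refine rearr_congr_dist fun l => ?_
  rw [set_eq_restrict (fun x => w (σ x)) (hw.comp hσ.measurable), set_eq_restrict _ hw]
  exact hσ.measure_preimage (measurableSet_lt measurable_const hw).nullMeasurableSet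

/-- resonance -/
theorem resonance {g w : ℝ → ℝ≥0∞} (hg : Measurable g) (hw : Measurable w) :
    ∃ w' : ℝ → ℝ≥0∞, Measurable w' ∧ rearr w' = rearr w ∧
      ∫⁻ t, rearr g t * w t ∂mu01 ≤ ∫⁻ t, g t * w' t ∂mu01 := by
  obtain ⟨σ, hσ, h⟩ := exists_sigma g hg
  refine ⟨fun x => w (σ x), hw.comp hσ.measurable, rearr_comp hσ hw, ?_⟩
  rw [← hσ.lintegral_comp (f := fun t => rearr g t * w t) ((rearr_meas g).mul hw)]
  refine lintegral_mono fun x => ?_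
  dsimp only
  gcongr
  exact h x

section ri
variable {ρ : (ℝ → ℝ≥0∞) → ℝ≥0∞}

theorem IsRiNorm.zero_iff (h : IsRiNorm ρ) {f : ℝ → ℝ≥0∞} (hf : Measurable f) :
    ρ f = 0 ↔ f =ᵐ[mu01] 0 := h.1 f hf
theorem IsRiNorm.smul (h : IsRiNorm ρ) {f : ℝ → ℝ≥0∞} (hf : Measurable f) {a : ℝ} (ha : 0 ≤ a) :
    ρ (fun t => ENNReal.ofReal a * f t) = ENNReal.ofReal a * ρ f := h.2.1 f hf a ha
theorem IsRiNorm.add (h : IsRiNorm ρ) {f g : ℝ → ℝ≥0∞} (hf : Measurable f) (hg : Measurable g) :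
    ρ (fun t => f t + g t) ≤ ρ f + ρ g := h.2.2.1 f g hf hg
theorem IsRiNorm.mono (h : IsRiNorm ρ) {f g : ℝ → ℝ≥0∞} (hf : Measurable f) (hg : Measurable g)
    (hfg : ∀ᵐ t ∂mu01, f t ≤ g t) : ρ f ≤ ρ g := h.2.2.2.1 f g hf hg hfg
theorem IsRiNorm.fatou (h : IsRiNorm ρ) {fn : ℕ → ℝ → ℝ≥0∞} {f : ℝ → ℝ≥0∞}
    (hfn : ∀ n, Measurable (fn n)) (hf : Measurable f)
    (hm : ∀ᵐ t ∂mu01, Monotone (fun n => fn n t)) (hs : ∀ᵐ t ∂mu01, (⨆ n, fn n t) = f t) :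
    (⨆ n, ρ (fn n)) = ρ f := h.2.2.2.2.1 fn f hfn hf hm hs
theorem IsRiNorm.one_lt (h : IsRiNorm ρ) : ρ (fun _ => 1) < ⊤ := h.2.2.2.2.2.1
theorem IsRiNorm.l1 (h : IsRiNorm ρ) : ∃ c : ℝ, 0 < c ∧ ∀ f : ℝ → ℝ≥0∞, Measurable f →
      ∫⁻ t, f t ∂mu01 ≤ ENNReal.ofReal c * ρ f := h.2.2.2.2.2.2.1
theorem IsRiNorm.ri (h : IsRiNorm ρ) {f : ℝ → ℝ≥0∞} (hf : Measurable f) : ρ f = ρ (rearr f) :=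
  h.2.2.2.2.2.2.2 f hf

theorem IsRiNorm.congr (h : IsRiNorm ρ) {f g : ℝ → ℝ≥0∞} (hf : Measurable f) (hg : Measurable g)
    (hfg : ∀ t ∈ Ioo (0:ℝ) 1, f t = g t) : ρ f = ρ g := by
  have : ∀ᵐ t ∂mu01, f t = g t := by
    filter_upwards [ae_restrict_mem measurableSet_Ioo] with t ht using hfg t ht
  exact le_antisymm (h.mono hf hg (this.mono fun t ht => ht.le)) (h.mono hg hf (this.mono fun t ht => ht.ge))

theorem IsRiNorm.eq_of_rearr (h : IsRiNorm ρ) {f g : ℝ → ℝ≥0∞} (hf : Measurable f) (hg : Measurable g)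
    (hfg : rearr f = rearr g) : ρ f = ρ g := by rw [h.ri hf, h.ri hg, hfg]

theorem IsRiNorm.smul' (h : IsRiNorm ρ) {f : ℝ → ℝ≥0∞} (hf : Measurable f) {a : ℝ≥0∞} (ha : a ≠ ⊤) :
    ρ (fun t => a * f t) = a * ρ f := by
  have := h.smul hf (ENNReal.toReal_nonneg (a := a))
  rwa [ENNReal.ofReal_toReal ha] at this

theorem IsRiNorm.one_pos (h : IsRiNorm ρ) : ρ (fun _ => 1) ≠ 0 := by
  intro h0
  obtain ⟨c, hc, hc2⟩ := h.l1
  have := hc2 (fun _ => 1) measurable_const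
  rw [h0] at this
  simp at this

theorem holder (h : IsRiNorm ρ) {v k : ℝ → ℝ≥0∞} (hv : Measurable v) (hvT : ρ v ≠ ⊤) :
    ∫⁻ t, k t * v t ∂mu01 ≤ ρ v * assoc ρ k := by
  rcases eq_or_ne (ρ v) 0 with h0 | h0
  · have h1 := (h.zero_iff hv).1 h0
    have : ∫⁻ t, k t * v t ∂mu01 = ∫⁻ t, 0 ∂mu01 := by
      refine lintegral_congr_ae ?_
      filter_upwards [h1] with t ht
      simp [ht]
    rw [this]; simp
  · have h2 : (ρ v)⁻¹ ≠ ⊤ := ENNReal.inv_ne_top.2 h0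
    have h1 : ∫⁻ t, k t * ((ρ v)⁻¹ * v t) ∂mu01 ≤ assoc ρ k := by
      unfold assoc
      refine le_iSup₂_of_le (fun t => (ρ v)⁻¹ * v t) ⟨hv.const_mul _, ?_⟩ le_rfl
      rw [h.smul' hv h2, ENNReal.inv_mul_cancel h0 hvT]
    calc ∫⁻ t, k t * v t ∂mu01 = ρ v * ∫⁻ t, k t * ((ρ v)⁻¹ * v t) ∂mu01 := by
          rw [← lintegral_const_mul' _ _ hvT]
          refine lintegral_congr fun t => ?_
          calc k t * v t = (ρ v * (ρ v)⁻¹) * (k t * v t) := by rw [ENNReal.mul_inv_cancel h0 hvT, one_mul]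
            _ = _ := by ring
      _ ≤ _ := by gcongr

end ri

/-- Lorentz type norms. -/
def Lam (W : Set (ℝ → ℝ≥0∞)) (f : ℝ → ℝ≥0∞) : ℝ≥0∞ :=
  ⨆ w ∈ W, ∫⁻ t, rearr f t * w t ∂mu01

theorem lam_le {W : Set (ℝ → ℝ≥0∞)} {w : ℝ → ℝ≥0∞} (hw : w ∈ W) (f : ℝ → ℝ≥0∞) :
    ∫⁻ t, rearr f t * w t ∂mu01 ≤ Lam W f := le_iSup₂_of_le w hw le_rfl

theorem comono {a b c d : ℝ≥0∞} (hab : a ≤ b) (hcd : c ≤ d) : a * d + b * c ≤ a * c + b * d := by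
  obtain ⟨x, rfl⟩ := exists_add_of_le hab
  obtain ⟨y, rfl⟩ := exists_add_of_le hcd
  calc a * (c + y) + (a + x) * c ≤ a * (c + y) + (a + x) * c + x * y := le_self_add
    _ = _ := by ring

theorem chebyshev {f w : ℝ → ℝ≥0∞} (hf : Measurable f) (hw : Measurable w)
    (hfa : AntitoneOn f (Ioo 0 1)) (hwa : AntitoneOn w (Ioo 0 1)) :
    (∫⁻ t, f t ∂mu01) * ∫⁻ t, w t ∂mu01 ≤ ∫⁻ t, f t * w t ∂mu01 := by
  have h1 : ∫⁻ x, ∫⁻ y, (f x * w y + f y * w x) ∂mu01 ∂mu01 ≤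
      ∫⁻ x, ∫⁻ y, (f x * w x + f y * w y) ∂mu01 ∂mu01 := by
    refine setLIntegral_mono' measurableSet_Ioo fun x hx => ?_
    refine setLIntegral_mono' measurableSet_Ioo fun y hy => ?_
    rcases le_total x y with h | h
    · have := comono (hfa hx hy h) (hwa hx hy h)
      calc _ = f y * w x + f x * w y := add_comm _ _
        _ ≤ _ := this
        _ = _ := add_comm _ _
    · exact comono (hfa hy hx h) (hwa hy hx h)
  have e1 : ∀ x, ∫⁻ y, (f x * w y + f y * w x) ∂mu01 =
      f x * (∫⁻ t, w t ∂mu01) + (∫⁻ t, f t ∂mu01) * w x := by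
    intro x
    rw [lintegral_add_left (hw.const_mul _), lintegral_const_mul _ hw, lintegral_mul_const _ hf]
  have e2 : ∀ x, ∫⁻ y, (f x * w x + f y * w y) ∂mu01 =
      f x * w x + ∫⁻ t, f t * w t ∂mu01 := by
    intro x
    rw [lintegral_add_left measurable_const]
    simp
  simp_rw [e1, e2] at h1
  rw [lintegral_add_left (hf.mul_const _), lintegral_mul_const _ hf, lintegral_const_mul _ hw,
    lintegral_add_left (f := fun x => f x * w x) (hf.mul hw)] at h1
  simp only [lintegral_const, Measure.restrict_apply_univ, Real.volume_Ioo, sub_zero,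
    ENNReal.ofReal_one, mul_one, ← two_mul] at h1
  exact (ENNReal.mul_le_mul_iff_right (by simp) (by simp)).1 h1

theorem lam_isRi {W : Set (ℝ → ℝ≥0∞)} (hWm : ∀ w ∈ W, Measurable w)
    (hWa : ∀ w ∈ W, AntitoneOn w (Ioo 0 1)) {K : ℝ≥0∞} (hK : K ≠ ⊤)
    (hWK : ∀ w ∈ W, ∫⁻ t, w t ∂mu01 ≤ K) {w0 : ℝ → ℝ≥0∞} (hw0 : w0 ∈ W)
    (hw0p : ∫⁻ t, w0 t ∂mu01 ≠ 0) : IsRiNorm (Lam W) := by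
  have hl1 : ∃ c : ℝ, 0 < c ∧ ∀ f : ℝ → ℝ≥0∞, Measurable f →
      ∫⁻ t, f t ∂mu01 ≤ ENNReal.ofReal c * Lam W f := by
    have hT : ∫⁻ t, w0 t ∂mu01 ≠ ⊤ := ne_top_of_le_ne_top hK (hWK w0 hw0)
    have hiT : (∫⁻ t, w0 t ∂mu01)⁻¹ ≠ ⊤ := ENNReal.inv_ne_top.2 hw0p
    refine ⟨((∫⁻ t, w0 t ∂mu01)⁻¹).toReal, ENNReal.toReal_pos (ENNReal.inv_ne_zero.2 hT) hiT, ?_⟩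
    intro f hf
    rw [ENNReal.ofReal_toReal hiT]
    have h1 := chebyshev (rearr_meas f) (hWm w0 hw0) ((rearr_antitone f).antitoneOn _) (hWa w0 hw0)
    rw [int_rearr hf] at h1
    have h2 := h1.trans (lam_le hw0 f)
    rw [mul_comm, ENNReal.mul_le_iff_le_inv hw0p hT] at h2
    exact h2
  refine ⟨?_, ?_, ?_, ?_, ?_, ?_, hl1, ?_⟩
  · intro f hf
    constructor
    · intro h0
      obtain ⟨c, hc, h⟩ := hl1
      have := h f hf
      rw [h0, mul_zero] at this
      exact (lintegral_eq_zero_iff hf).1 (le_antisymm this bot_le)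
    · intro h
      have h0 : ∀ t, 0 ≤ t → rearr f t = 0 := by
        intro t ht
        refine le_antisymm ?_ bot_le
        rw [rearr_le_iff, set_eq_restrict f hf]
        have : mu01 {s | 0 < f s} = 0 := by
          have h2 : ∀ᵐ s ∂mu01, ¬ (0 < f s) := by
            filter_upwards [h] with s hs
            simp [hs]
          rw [ae_iff] at h2
          simpa only [not_not] using h2
        rw [this]; simp
      refine le_antisymm (iSup₂_le fun w hw => ?_) bot_le
      have : ∫⁻ t, rearr f t * w t ∂mu01 = ∫⁻ t, 0 ∂mu01 := by
        refine setLIntegral_congr_fun measurableSet_Ioo fun t ht => ?_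
        simp [h0 t ht.1.le]
      rw [this]; simp
  · intro f hf a ha
    unfold Lam
    simp_rw [rearr_const_mul f a ha, ENNReal.mul_iSup]
    congr 1; ext w; congr 1; ext hw
    rw [← lintegral_const_mul' _ _ ENNReal.ofReal_ne_top]
    simp_rw [mul_assoc]
  · intro f g hf hg
    refine iSup₂_le fun w hw => ?_
    obtain ⟨w', hw', hww, h⟩ := resonance (hf.add hg) (hWm w hw)
    refine (le_trans h ?_)
    have hb : ∀ k : ℝ → ℝ≥0∞, Measurable k → ∫⁻ t, k t * w' t ∂mu01 ≤ Lam W k := by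
      intro k hk
      refine (hardy_littlewood hk hw').trans (le_trans ?_ (lam_le hw k))
      rw [hww]
      refine setLIntegral_mono' measurableSet_Ioo fun t ht => ?_
      gcongr
      exact rearr_le_self (hWa w hw) ht
    simp only [Pi.add_apply, add_mul]
    rw [lintegral_add_left (f := fun x => f x * w' x) (hf.mul hw')]
    exact add_le_add (hb f hf) (hb g hg)
  · intro f g hf hg hfg
    refine iSup₂_mono fun w hw => lintegral_mono fun t => ?_
    exact mul_le_mul_left (rearr_mono hf hg hfg t) _
  · intro fn f hfn hf hm hs
    unfold Lam
    rw [iSup_comm]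
    congr 1; ext w
    rw [iSup_comm]
    congr 1; ext hw
    simp_rw [← rearr_iSup hfn hf hm hs, ENNReal.iSup_mul]
    rw [lintegral_iSup']
    · exact fun n => ((rearr_meas _).mul (hWm w hw)).aemeasurable
    · refine Eventually.of_forall fun t m n hmn => ?_
      refine mul_le_mul_left (rearr_mono (hfn m) (hfn n) ?_ t) _
      filter_upwards [hm] with s hs using hs hmn
  · refine lt_of_le_of_lt ?_ (lt_top_iff_ne_top.2 hK)
    refine iSup₂_le fun w hw => le_trans ?_ (hWK w hw)
    refine lintegral_mono fun t => ?_
    have : rearr (fun _ => 1) t ≤ 1 := by rw [rearr_le_iff]; simp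
    calc _ ≤ 1 * w t := by gcongr
      _ = w t := one_mul _
  · intro f hf
    unfold Lam
    rw [rearr_rearr]

theorem ll_convex {ρ : (ℝ → ℝ≥0∞) → ℝ≥0∞} (h : IsRiNorm ρ) (r : ℝ≥0∞) :
    Convex ℝ {φ : Lp ℝ 2 mu01 | ρ (fun x => ‖φ x‖ₑ) ≤ r} := by
  intro φ hφ ψ hψ a b ha hb hab
  have m1 : Measurable (fun x => ‖φ x‖ₑ) := (Lp.stronglyMeasurable φ).measurable.enorm
  have m2 : Measurable (fun x => ‖ψ x‖ₑ) := (Lp.stronglyMeasurable ψ).measurable.enorm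
  have m3 : Measurable (fun x => ‖(a • φ + b • ψ : Lp ℝ 2 mu01) x‖ₑ) := (Lp.stronglyMeasurable _).measurable.enorm
  calc ρ (fun x => ‖(a • φ + b • ψ : Lp ℝ 2 mu01) x‖ₑ)
      ≤ ρ (fun x => ENNReal.ofReal a * ‖φ x‖ₑ + ENNReal.ofReal b * ‖ψ x‖ₑ) := by
        refine h.mono m3 ((m1.const_mul _).add (m2.const_mul _)) ?_
        filter_upwards [Lp.coeFn_add (a • φ) (b • ψ), Lp.coeFn_smul a φ, Lp.coeFn_smul b ψ] with x h1 h2 h3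
        rw [h1, Pi.add_apply, h2, h3]
        refine (enorm_add_le _ _).trans ?_
        simp [enorm_smul, Real.enorm_of_nonneg ha, Real.enorm_of_nonneg hb]
    _ ≤ ρ (fun x => ENNReal.ofReal a * ‖φ x‖ₑ) + ρ (fun x => ENNReal.ofReal b * ‖ψ x‖ₑ) :=
        h.add (m1.const_mul _) (m2.const_mul _)
    _ = ENNReal.ofReal a * ρ (fun x => ‖φ x‖ₑ) + ENNReal.ofReal b * ρ (fun x => ‖ψ x‖ₑ) := by
        rw [h.smul m1 ha, h.smul m2 hb]
    _ ≤ ENNReal.ofReal a * r + ENNReal.ofReal b * r := by gcongr <;> assumption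
    _ = r := by rw [← add_mul, ← ENNReal.ofReal_add ha hb, hab]; simp

theorem ll_closed {ρ : (ℝ → ℝ≥0∞) → ℝ≥0∞} (h : IsRiNorm ρ) (r : ℝ≥0∞) :
    IsClosed {φ : Lp ℝ 2 mu01 | ρ (fun x => ‖φ x‖ₑ) ≤ r} := by
  refine IsSeqClosed.isClosed ?_
  intro φ ψ hφ hlim
  obtain ⟨ns, hns, hae⟩ := (tendstoInMeasure_of_tendsto_Lp hlim).exists_seq_tendsto_ae
  have m : ∀ χ : Lp ℝ 2 mu01, Measurable (fun x => ‖χ x‖ₑ) := fun χ =>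
    (Lp.stronglyMeasurable χ).measurable.enorm
  have mg : ∀ k, Measurable (fun x => ⨅ j, ‖φ (ns (k + j)) x‖ₑ) := fun k =>
    Measurable.iInf fun j => m _
  change ρ (fun x => ‖ψ x‖ₑ) ≤ r
  rw [← h.fatou (fn := fun k x => ⨅ j, ‖φ (ns (k + j)) x‖ₑ) mg (m ψ)]
  · refine iSup_le fun k => le_trans (h.mono (mg k) (m _) ?_) (hφ (ns k))
    refine Eventually.of_forall fun x => ?_
    exact iInf_le_of_le 0 (by simp)
  · refine Eventually.of_forall fun x => ?_
    intro a b hab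
    refine le_iInf fun j => iInf_le_of_le (b - a + j) ?_
    rw [show a + (b - a + j) = b + j by omega]
  · filter_upwards [hae] with x hx
    have h1 : Tendsto (fun i => ‖φ (ns i) x‖ₑ) atTop (nhds ‖ψ x‖ₑ) := hx.enorm
    rw [← h1.liminf_eq, liminf_eq_iSup_iInf_of_nat']
    simp_rw [add_comm]

theorem ll_bdd {ρ : (ℝ → ℝ≥0∞) → ℝ≥0∞} (h : IsRiNorm ρ) {f : ℝ → ℝ≥0∞} (hf : Measurable f) {n : ℝ}
    (hfn : ∀ t, f t ≤ ENNReal.ofReal n) {r : ℝ} (hr : 0 < r) (hfr : ENNReal.ofReal r < ρ f) :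
    ∃ g : ℝ → ℝ≥0∞, Measurable g ∧ assoc ρ g ≤ 1 ∧ ENNReal.ofReal r ≤ ∫⁻ t, f t * g t ∂mu01 := by
  have hfT : ∀ t, f t ≠ ⊤ := fun t => ne_top_of_le_ne_top ENNReal.ofReal_ne_top (hfn t)
  have mem : ∀ (k : ℝ → ℝ≥0∞) (n : ℝ), Measurable k → (∀ t, k t ≤ ENNReal.ofReal n) →
      ∀ s : ℝ → ℝ, Measurable s → (∀ t, |s t| ≤ 1) → MemLp (fun t => (k t).toReal * s t) 2 mu01 := by
    intro k n hk hkn s hs hs1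
    refine MemLp.of_bound (hk.ennreal_toReal.mul hs).aestronglyMeasurable (max n 0) ?_
    refine Eventually.of_forall fun t => ?_
    rw [norm_mul, Real.norm_eq_abs, Real.norm_eq_abs, abs_of_nonneg ENNReal.toReal_nonneg]
    have h1 : (k t).toReal ≤ max n 0 := by
      have := ENNReal.toReal_mono ENNReal.ofReal_ne_top (hkn t)
      rwa [ENNReal.toReal_ofReal'] at this
    calc _ ≤ max n 0 * 1 := mul_le_mul h1 (hs1 t) (abs_nonneg _) (le_max_right _ _)
      _ = _ := mul_one _
  have hF := mem f n hf hfn (fun _ => 1) measurable_const (by simp)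
  set F : Lp ℝ 2 mu01 := hF.toLp _ with hFd
  have hFe : ∀ᵐ t ∂mu01, ‖F t‖ₑ = f t := by
    filter_upwards [hF.coeFn_toLp] with t ht
    rw [hFd, ht, mul_one, Real.enorm_of_nonneg ENNReal.toReal_nonneg, ENNReal.ofReal_toReal (hfT t)]
  have hFn : F ∉ {φ : Lp ℝ 2 mu01 | ρ (fun x => ‖φ x‖ₑ) ≤ ENNReal.ofReal r} := by
    intro hc
    refine absurd (le_trans ?_ hc) (not_le.2 hfr)
    exact h.mono hf (Lp.stronglyMeasurable F).measurable.enorm (hFe.mono fun t ht => ht.ge)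
  obtain ⟨L, u, hL1, hL2⟩ := geometric_hahn_banach_closed_point (ll_convex h (ENNReal.ofReal r))
    (ll_closed h (ENNReal.ofReal r)) hFn
  set ψ : Lp ℝ 2 mu01 := (InnerProductSpace.toDual ℝ _).symm L with hψd
  have hLψ : ∀ φ, L φ = ∫ t, φ t * ψ t ∂mu01 := by
    intro φ
    rw [← InnerProductSpace.toDual_symm_apply, L2.inner_def]
    rfl
  have hψm : Measurable ψ := (Lp.stronglyMeasurable ψ).measurable
  have hu : 0 < u := by
    have := hL1 0 (by
      change ρ _ ≤ _
      have : ρ (fun x => ‖(0 : Lp ℝ 2 mu01) x‖ₑ) = 0 := by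
        rw [h.zero_iff (Lp.stronglyMeasurable _).measurable.enorm]
        filter_upwards [Lp.coeFn_zero ℝ 2 mu01] with t ht
        change ‖((0 : Lp ℝ 2 mu01) : ℝ → ℝ) t‖ₑ = 0
        rw [ht]; simp
      rw [this]; exact bot_le)
    simpa using this
  -- bound on bounded functions
  have hb : ∀ (k : ℝ → ℝ≥0∞) (N : ℝ), Measurable k → (∀ t, k t ≤ ENNReal.ofReal N) → ρ k ≤ 1 →
      ENNReal.ofReal r * ∫⁻ t, ‖ψ t‖ₑ * k t ∂mu01 ≤ ENNReal.ofReal u := by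
    intro k N hk hkN hk1
    have hkT : ∀ t, k t ≠ ⊤ := fun t => ne_top_of_le_ne_top ENNReal.ofReal_ne_top (hkN t)
    set s : ℝ → ℝ := fun t => if 0 ≤ ψ t then 1 else -1 with hs
    have hsm : Measurable s := Measurable.ite (measurableSet_le measurable_const hψm) measurable_const measurable_const
    have hs1 : ∀ t, |s t| = 1 := by intro t; simp only [hs]; split_ifs <;> simp
    have hsψ : ∀ t, s t * ψ t = |ψ t| := by
      intro t; simp only [hs]; split_ifs with h0
      · rw [abs_of_nonneg h0, one_mul]
      · rw [abs_of_neg (not_le.1 h0), neg_one_mul]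
    have hM := mem (fun t => ENNReal.ofReal r * k t) (r * N) (hk.const_mul _)
      (fun t => by rw [ENNReal.ofReal_mul hr.le]; gcongr; exact hkN t) s hsm (fun t => (hs1 t).le)
    set φ : Lp ℝ 2 mu01 := hM.toLp _ with hφd
    have hφe : ∀ᵐ t ∂mu01, ‖φ t‖ₑ ≤ ENNReal.ofReal r * k t := by
      filter_upwards [hM.coeFn_toLp] with t ht
      rw [hφd, ht, enorm_mul, Real.enorm_of_nonneg ENNReal.toReal_nonneg,
        ENNReal.ofReal_toReal (ENNReal.mul_ne_top ENNReal.ofReal_ne_top (hkT t)),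
        Real.enorm_eq_ofReal_abs, hs1]
      simp
    have h1 := hL1 φ (by
      change ρ _ ≤ _
      calc _ ≤ ρ (fun t => ENNReal.ofReal r * k t) :=
            h.mono (Lp.stronglyMeasurable _).measurable.enorm (hk.const_mul _) hφe
        _ = ENNReal.ofReal r * ρ k := h.smul hk hr.le
        _ ≤ ENNReal.ofReal r * 1 := by gcongr
        _ = _ := mul_one _)
    rw [hLψ] at h1
    have hint : Integrable (fun t => φ t * ψ t) mu01 := by
      have := L2.integrable_inner (𝕜 := ℝ) ψ φ
      exact this
    have hae : ∀ᵐ t ∂mu01, φ t * ψ t = (ENNReal.ofReal r * k t).toReal * |ψ t| := by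
      filter_upwards [hM.coeFn_toLp] with t ht
      rw [hφd, ht, mul_assoc, hsψ]
    have h2 := ofReal_integral_eq_lintegral_ofReal hint (by
      filter_upwards [hae] with t ht
      rw [ht]; exact mul_nonneg ENNReal.toReal_nonneg (abs_nonneg _))
    have h3 : ∫⁻ t, ENNReal.ofReal (φ t * ψ t) ∂mu01 = ENNReal.ofReal r * ∫⁻ t, ‖ψ t‖ₑ * k t ∂mu01 := by
      rw [← lintegral_const_mul' _ _ ENNReal.ofReal_ne_top]
      refine lintegral_congr_ae ?_
      filter_upwards [hae] with t ht
      rw [ht, ENNReal.ofReal_mul ENNReal.toReal_nonneg,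
        ENNReal.ofReal_toReal (ENNReal.mul_ne_top ENNReal.ofReal_ne_top (hkT t)), Real.enorm_eq_ofReal_abs]
      ring
    rw [← h3, ← h2]
    exact ENNReal.ofReal_le_ofReal h1.le
  have hur : ENNReal.ofReal (r / u) ≠ 0 := by simp; positivity
  have hub : ∀ k : ℝ → ℝ≥0∞, Measurable k → ρ k ≤ 1 →
      ENNReal.ofReal r * ∫⁻ t, ‖ψ t‖ₑ * k t ∂mu01 ≤ ENNReal.ofReal u := by
    intro k hk hk1
    have e : ∫⁻ t, ‖ψ t‖ₑ * k t ∂mu01 = ⨆ n : ℕ, ∫⁻ t, ‖ψ t‖ₑ * min (k t) n ∂mu01 := by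
      rw [← lintegral_iSup']
      · refine lintegral_congr fun t => ?_
        rw [← ENNReal.mul_iSup]
        congr 1
        change _ = ⨆ n : ℕ, k t ⊓ (n:ℝ≥0∞)
        rw [← inf_iSup_eq, ENNReal.iSup_natCast, inf_top_eq]
      · exact fun n => (hψm.enorm.mul (hk.min measurable_const)).aemeasurable
      · refine Eventually.of_forall fun t a b hab => ?_
        dsimp only
        gcongr
    rw [e, ENNReal.mul_iSup]
    refine iSup_le fun n => ?_
    refine hb (fun t => min (k t) n) n (hk.min measurable_const) (fun t => by simp) ?_
    exact (h.mono (hk.min measurable_const) hk (Eventually.of_forall fun t => min_le_left _ _)).trans hk1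
  have hu0 : ENNReal.ofReal u ≠ 0 := by simpa using hu
  refine ⟨fun t => ENNReal.ofReal r / ENNReal.ofReal u * ‖ψ t‖ₑ, hψm.enorm.const_mul _, ?_, ?_⟩
  · refine iSup₂_le fun k hk => ?_
    have := hub k hk.1 hk.2
    simp_rw [mul_assoc]
    rw [lintegral_const_mul' _ _ (ENNReal.div_ne_top ENNReal.ofReal_ne_top hu0)]
    calc _ = (ENNReal.ofReal r * ∫⁻ t, ‖ψ t‖ₑ * k t ∂mu01) / ENNReal.ofReal u := by
          simp only [div_eq_mul_inv]; ring
      _ ≤ ENNReal.ofReal u / ENNReal.ofReal u := by gcongr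
      _ ≤ 1 := ENNReal.div_self_le_one
  · have h1 : ENNReal.ofReal u ≤ ∫⁻ t, f t * ‖ψ t‖ₑ ∂mu01 := by
      calc ENNReal.ofReal u ≤ ENNReal.ofReal (L F) := ENNReal.ofReal_le_ofReal hL2.le
        _ ≤ ‖L F‖ₑ := by rw [Real.enorm_eq_ofReal_abs]; exact ENNReal.ofReal_le_ofReal (le_abs_self _)
        _ ≤ ∫⁻ t, ‖F t * ψ t‖ₑ ∂mu01 := by rw [hLψ]; exact enorm_integral_le_lintegral_enorm _
        _ = _ := by
          refine lintegral_congr_ae ?_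
          filter_upwards [hFe] with t ht
          rw [enorm_mul, ht]
    calc ENNReal.ofReal r = ENNReal.ofReal r / ENNReal.ofReal u * ENNReal.ofReal u :=
          (ENNReal.div_mul_cancel hu0 ENNReal.ofReal_ne_top).symm
      _ ≤ ENNReal.ofReal r / ENNReal.ofReal u * ∫⁻ t, f t * ‖ψ t‖ₑ ∂mu01 := by gcongr
      _ = _ := by
        rw [← lintegral_const_mul' _ _ (ENNReal.div_ne_top ENNReal.ofReal_ne_top hu0)]
        refine lintegral_congr fun t => ?_
        ring

/-- Lorentz–Luxemburg. -/
theorem lorentz_luxemburg {ρ : (ℝ → ℝ≥0∞) → ℝ≥0∞} (h : IsRiNorm ρ) {f : ℝ → ℝ≥0∞} (hf : Measurable f)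
    {M : ℝ≥0∞} (hM : ∀ g : ℝ → ℝ≥0∞, Measurable g → assoc ρ g ≤ 1 → ∫⁻ t, f t * g t ∂mu01 ≤ M) :
    ρ f ≤ M := by
  have hmn : ∀ n : ℕ, Measurable (fun t => min (f t) n) := fun n => hf.min measurable_const
  rw [← h.fatou (fn := fun n t => min (f t) n) hmn hf]
  · refine iSup_le fun n => ?_
    by_contra hc
    obtain ⟨r, hr0, hr1, hr2⟩ := ENNReal.lt_iff_exists_real_btwn.1 (not_le.1 hc)
    have hr : 0 < r := by
      by_contra hn
      rw [ENNReal.ofReal_of_nonpos (not_lt.1 hn)] at hr1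
      exact absurd hr1 (by simp)
    obtain ⟨g, hg, hg1, hg2⟩ := ll_bdd h (hmn n) (n := n) (fun t => by simp) hr hr2
    refine absurd (hg2.trans (le_trans (lintegral_mono fun t => ?_) (hM g hg hg1))) (not_le.2 hr1)
    dsimp only
    gcongr
    exact min_le_left _ _
  · refine Eventually.of_forall fun t a b hab => ?_
    dsimp only
    gcongr
  · refine Eventually.of_forall fun t => ?_
    change (⨆ n : ℕ, f t ⊓ (n:ℝ≥0∞)) = _
    rw [← inf_iSup_eq, ENNReal.iSup_natCast, inf_top_eq]

theorem tri {μ : Measure ℝ} [SFinite μ] {a b : ℝ → ℝ≥0∞} (ha : Measurable a) (hb : Measurable b) :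
    ∫⁻ t, b t * (∫⁻ s, (if t < s then a s else 0) ∂μ) ∂μ
      = ∫⁻ s, a s * (∫⁻ t, (if t < s then b t else 0) ∂μ) ∂μ := by
  have hm : Measurable (fun p : ℝ × ℝ => if p.1 < p.2 then b p.1 * a p.2 else 0) :=
    Measurable.ite (measurableSet_lt measurable_fst measurable_snd)
      ((hb.comp measurable_fst).mul (ha.comp measurable_snd)) measurable_const
  have h1 : ∀ t, b t * (∫⁻ s, (if t < s then a s else 0) ∂μ)
      = ∫⁻ s, (if t < s then b t * a s else 0) ∂μ := by
    intro t
    rw [← lintegral_const_mul _ (Measurable.ite measurableSet_Ioi ha measurable_const)]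
    congr 1; ext s; split_ifs <;> simp
  have h2 : ∀ s, a s * (∫⁻ t, (if t < s then b t else 0) ∂μ)
      = ∫⁻ t, (if t < s then b t * a s else 0) ∂μ := by
    intro s
    rw [← lintegral_const_mul _ (Measurable.ite measurableSet_Iio hb measurable_const)]
    congr 1; ext t; split_ifs <;> simp [mul_comm]
  simp_rw [h1, h2]
  exact lintegral_lintegral_swap hm.aemeasurable

theorem ind_left {a : ℝ → ℝ≥0∞} {s T : ℝ} (hs : s ≤ T) :
    ∫⁻ t in Ioo 0 T, (if t < s then a t else 0) = ∫⁻ t in Ioo 0 s, a t := by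
  have : (fun t => if t < s then a t else 0) = (Iio s).indicator a := by
    ext t; simp [indicator]
  rw [this, lintegral_indicator measurableSet_Iio, Measure.restrict_restrict measurableSet_Iio]
  congr 2; ext x; simp only [mem_inter_iff, mem_Iio, mem_Ioo]; constructor
  · rintro ⟨h1, h2, h3⟩; exact ⟨h2, h1⟩
  · rintro ⟨h1, h2⟩; exact ⟨h2, h1, h2.trans_le hs⟩

theorem ind_right {a : ℝ → ℝ≥0∞} {t T : ℝ} (ht : 0 ≤ t) :
    ∫⁻ s in Ioo 0 T, (if t < s then a s else 0) = ∫⁻ s in Ioo t T, a s := by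
  have : (fun s => if t < s then a s else 0) = (Ioi t).indicator a := by
    ext t; simp [indicator]
  rw [this, lintegral_indicator measurableSet_Ioi, Measure.restrict_restrict measurableSet_Ioi]
  congr 2; ext x; simp only [mem_inter_iff, mem_Ioi, mem_Ioo]; constructor
  · rintro ⟨h1, h2, h3⟩; exact ⟨h1, h3⟩
  · rintro ⟨h1, h2⟩; exact ⟨h1, ht.trans_lt h1, h2⟩

/-- triangle Tonelli on `(0,T)` -/
theorem tri_T {a b : ℝ → ℝ≥0∞} (ha : Measurable a) (hb : Measurable b) (T : ℝ) :
    ∫⁻ t in Ioo 0 T, b t * (∫⁻ s in Ioo t T, a s)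
      = ∫⁻ s in Ioo 0 T, a s * (∫⁻ t in Ioo 0 s, b t) := by
  have := tri (μ := volume.restrict (Ioo 0 T)) ha hb
  refine (setLIntegral_congr_fun measurableSet_Ioo ?_).trans (this.trans
    (setLIntegral_congr_fun measurableSet_Ioo ?_))
  · intro t ht; simp only; rw [ind_right ht.1.le]
  · intro s hs; simp only; rw [ind_left hs.2.le]

/-- abstract form of the hypotheses on `I` -/
structure Adm (i : ℝ → ℝ≥0∞) (C : ℝ≥0∞) : Prop where
  meas : Measurable i
  pos : ∀ s, i s ≠ 0
  fin : ∀ s, i s ≠ ⊤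
  mono : MonotoneOn i (Ioo 0 1)
  quasi : ∀ s ∈ Ioo (0:ℝ) 1, ∀ t ∈ Ioo (0:ℝ) 1, s ≤ t →
    i t / ENNReal.ofReal t ≤ i s / ENNReal.ofReal s
  star : ∀ t ∈ Ioo (0:ℝ) 1, ∫⁻ s in Ioo 0 t, i s / ENNReal.ofReal s ≤ C * i t
  avg : ∀ t ∈ Ioo (0:ℝ) 1, ∫⁻ s in Ioo 0 t, (i s)⁻¹ ≤ C * (ENNReal.ofReal t / i t)
  low : ∀ t ∈ Ioo (0:ℝ) 1, ENNReal.ofReal t ≤ i t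
  CT : C ≠ ⊤

def Hop (i f : ℝ → ℝ≥0∞) (t : ℝ) : ℝ≥0∞ := ∫⁻ s in Ioo t 1, f s / i s
def Rop (i f : ℝ → ℝ≥0∞) (t : ℝ) : ℝ≥0∞ := (i t)⁻¹ * ∫⁻ s in Ioo 0 t, f s
def Phi (i f : ℝ → ℝ≥0∞) (t : ℝ) : ℝ≥0∞ := ⨆ s ∈ Ico t 1, (ENNReal.ofReal s / i s) * rearr f s
def Tp (i f : ℝ → ℝ≥0∞) (t : ℝ) : ℝ≥0∞ := (i t / ENNReal.ofReal t) * Phi i f t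

theorem Hop_anti (i f : ℝ → ℝ≥0∞) : Antitone (Hop i f) := fun _ _ h =>
  lintegral_mono_set (Ioo_subset_Ioo_left h)
theorem Hop_meas (i f : ℝ → ℝ≥0∞) : Measurable (Hop i f) := (Hop_anti i f).measurable
theorem Phi_anti (i f : ℝ → ℝ≥0∞) : Antitone (Phi i f) := fun _ _ h =>
  biSup_mono fun _ hs => ⟨h.trans hs.1, hs.2⟩
theorem Phi_meas (i f : ℝ → ℝ≥0∞) : Measurable (Phi i f) := (Phi_anti i f).measurable

theorem prim_mono (f : ℝ → ℝ≥0∞) : Monotone (fun t => ∫⁻ s in Ioo 0 t, f s) := fun _ _ h =>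
  lintegral_mono_set (Ioo_subset_Ioo_right h)

section
variable {i : ℝ → ℝ≥0∞} {C : ℝ≥0∞}

theorem Rop_meas (h : Adm i C) (f : ℝ → ℝ≥0∞) : Measurable (Rop i f) :=
  h.meas.inv.mul (prim_mono f).measurable
theorem Tp_meas (h : Adm i C) (f : ℝ → ℝ≥0∞) : Measurable (Tp i f) :=
  (h.meas.div ENNReal.measurable_ofReal).mul (Phi_meas i f)

theorem Tp_anti (h : Adm i C) (f : ℝ → ℝ≥0∞) : AntitoneOn (Tp i f) (Ioo 0 1) :=
  fun s hs t ht hst => mul_le_mul' (h.quasi s hs t ht hst) (Phi_anti i f hst)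

theorem of_ne {t : ℝ} (ht : t ∈ Ioo (0:ℝ) 1) : ENNReal.ofReal t ≠ 0 := by
  simpa using ht.1

theorem ratio_one (h : Adm i C) {t : ℝ} (ht : t ∈ Ioo (0:ℝ) 1) :
    (i t / ENNReal.ofReal t) * (ENNReal.ofReal t / i t) = 1 := by
  rw [ENNReal.div_eq_inv_mul, ENNReal.div_eq_inv_mul, mul_mul_mul_comm, mul_comm (i t),
    ← mul_mul_mul_comm, ENNReal.inv_mul_cancel (of_ne ht) ENNReal.ofReal_ne_top,
    ENNReal.inv_mul_cancel (h.pos t) (h.fin t), one_mul]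

theorem le_Phi {t : ℝ} (ht : t ∈ Ioo (0:ℝ) 1) (f : ℝ → ℝ≥0∞) :
    (ENNReal.ofReal t / i t) * rearr f t ≤ Phi i f t :=
  le_iSup₂_of_le (f := fun s (_ : s ∈ Ico t 1) => (ENNReal.ofReal s / i s) * rearr f s) t ⟨le_rfl, ht.2⟩ le_rfl

theorem rearr_le_Tp (h : Adm i C) (f : ℝ → ℝ≥0∞) {t : ℝ} (ht : t ∈ Ioo (0:ℝ) 1) :
    rearr f t ≤ Tp i f t := by
  calc rearr f t = (i t / ENNReal.ofReal t) * ((ENNReal.ofReal t / i t) * rearr f t) := by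
        rw [← mul_assoc, ratio_one h ht, one_mul]
    _ ≤ _ := by unfold Tp; gcongr; exact le_Phi ht f

theorem duality (h : Adm i C) {f g : ℝ → ℝ≥0∞} (hf : Measurable f) (hg : Measurable g) :
    ∫⁻ t, Hop i f t * g t ∂mu01 = ∫⁻ t, f t * Rop i g t ∂mu01 := by
  have := tri_T (hf.div h.meas) hg 1
  calc ∫⁻ t, Hop i f t * g t ∂mu01 = ∫⁻ t in Ioo 0 1, g t * (∫⁻ s in Ioo t 1, f s / i s) := by
        simp_rw [mul_comm (g _)]; rfl
    _ = _ := this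
    _ = _ := by
        refine lintegral_congr fun t => ?_
        simp only [Rop, Pi.div_apply]
        rw [ENNReal.div_eq_inv_mul]; ring

/-- sup over `[s,t)` -/
theorem Phi_split (h : Adm i C) (f : ℝ → ℝ≥0∞) {s t : ℝ} (hs : s ∈ Ioo (0:ℝ) 1) (ht : t ∈ Ioo (0:ℝ) 1) :
    Phi i f s ≤ (ENNReal.ofReal s / i s) * rearr f s + (∫⁻ r in Ioo s t, rearr f r / i r) + Phi i f t := by
  refine iSup₂_le fun r hr => ?_
  rcases le_or_gt t r with htr | hrt
  · exact le_add_left (le_iSup₂_of_le (f := fun s (_ : s ∈ Ico t 1) => (ENNReal.ofReal s / i s) * rearr f s) r ⟨htr, hr.2⟩ le_rfl)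
  refine le_add_right ?_
  have hr' : r ∈ Ioo (0:ℝ) 1 := ⟨hs.1.trans_le hr.1, hr.2⟩
  have e : ENNReal.ofReal r = ENNReal.ofReal s + ENNReal.ofReal (r - s) := by
    rw [← ENNReal.ofReal_add hs.1.le (by linarith [hr.1])]; congr 1; ring
  rw [e, ENNReal.add_div, add_mul]
  refine add_le_add ?_ ?_
  · gcongr
    · exact h.mono hs hr' hr.1
    · exact rearr_antitone f hr.1
  · calc ENNReal.ofReal (r - s) / i r * rearr f r = ∫⁻ _ in Ioo s r, rearr f r / i r := by
          rw [setLIntegral_const, Real.volume_Ioo, ENNReal.div_eq_inv_mul, ENNReal.div_eq_inv_mul]; ring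
      _ ≤ ∫⁻ x in Ioo s r, rearr f x / i x := by
          refine setLIntegral_mono' measurableSet_Ioo fun x hx => ?_
          gcongr
          · exact rearr_antitone f hx.2.le
          · exact h.mono ⟨hs.1.trans hx.1, hx.2.trans hr'.2⟩ hr' hx.2.le
      _ ≤ _ := lintegral_mono_set (Ioo_subset_Ioo_right hrt.le)

theorem RT_le (h : Adm i C) (f : ℝ → ℝ≥0∞) {t : ℝ} (ht : t ∈ Ioo (0:ℝ) 1) :
    Rop i (Tp i f) t ≤ (1 + C) * Rop i (rearr f) t + C * Phi i f t := by
  have hm : Measurable (rearr f) := rearr_meas f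
  have hq : Measurable (fun s => i s / ENNReal.ofReal s) := h.meas.div ENNReal.measurable_ofReal
  have hin : Measurable (fun s => ∫⁻ r in Ioo s t, rearr f r / i r) :=
    (show Antitone (fun s => ∫⁻ r in Ioo s t, rearr f r / i r) from
      fun _ _ h => lintegral_mono_set (Ioo_subset_Ioo_left h)).measurable
  have h1 : ∫⁻ s in Ioo 0 t, Tp i f s ≤ (1 + C) * (∫⁻ s in Ioo 0 t, rearr f s) + C * i t * Phi i f t := by
    calc ∫⁻ s in Ioo 0 t, Tp i f s
        ≤ ∫⁻ s in Ioo 0 t, ((rearr f s + (i s / ENNReal.ofReal s) * (∫⁻ r in Ioo s t, rearr f r / i r))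
            + (i s / ENNReal.ofReal s) * Phi i f t) := by
          refine setLIntegral_mono' measurableSet_Ioo fun s hs => ?_
          have hs' : s ∈ Ioo (0:ℝ) 1 := ⟨hs.1, hs.2.trans ht.2⟩
          calc Tp i f s ≤ (i s / ENNReal.ofReal s) * ((ENNReal.ofReal s / i s) * rearr f s + (∫⁻ r in Ioo s t, rearr f r / i r) + Phi i f t) := by
                unfold Tp; gcongr; exact Phi_split h f hs' ht
            _ = _ := by rw [mul_add, mul_add, ← mul_assoc, ratio_one h hs', one_mul]
      _ = (∫⁻ s in Ioo 0 t, rearr f s) + (∫⁻ s in Ioo 0 t, rearr f s / i s * (∫⁻ x in Ioo 0 s, i x / ENNReal.ofReal x))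
            + (∫⁻ s in Ioo 0 t, (i s / ENNReal.ofReal s)) * Phi i f t := by
          rw [lintegral_add_left (f := fun s => rearr f s + (i s / ENNReal.ofReal s) * (∫⁻ r in Ioo s t, rearr f r / i r)) (hm.add (hq.mul hin)), lintegral_add_left hm, lintegral_mul_const _ hq]
          congr 2
          exact tri_T (hm.div h.meas) hq t
      _ ≤ (∫⁻ s in Ioo 0 t, rearr f s) + C * (∫⁻ s in Ioo 0 t, rearr f s) + C * i t * Phi i f t := by
          refine add_le_add (add_le_add le_rfl ?_) (mul_le_mul_left ?_ _)
          · rw [← lintegral_const_mul _ hm]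
            refine setLIntegral_mono' measurableSet_Ioo fun s hs => ?_
            have hs' : s ∈ Ioo (0:ℝ) 1 := ⟨hs.1, hs.2.trans ht.2⟩
            calc rearr f s / i s * (∫⁻ x in Ioo 0 s, i x / ENNReal.ofReal x) ≤ rearr f s / i s * (C * i s) := by
                  gcongr; exact h.star s hs'
              _ = C * rearr f s * ((i s)⁻¹ * i s) := by rw [ENNReal.div_eq_inv_mul]; ring
              _ = C * rearr f s := by rw [ENNReal.inv_mul_cancel (h.pos s) (h.fin s), mul_one]
          · exact h.star t ht
      _ = _ := by ring
  calc Rop i (Tp i f) t ≤ (i t)⁻¹ * ((1 + C) * (∫⁻ s in Ioo 0 t, rearr f s) + C * i t * Phi i f t) := by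
        unfold Rop; gcongr
    _ = (1 + C) * Rop i (rearr f) t + ((i t)⁻¹ * i t) * (C * Phi i f t) := by unfold Rop; ring
    _ = _ := by rw [ENNReal.inv_mul_cancel (h.pos t) (h.fin t), one_mul]

/-- `R(T g) ≥ Φ`. -/
theorem Phi_le_RT (h : Adm i C) (f : ℝ → ℝ≥0∞) {t : ℝ} (ht : t ∈ Ioo (0:ℝ) 1) :
    Phi i f t ≤ Rop i (Tp i f) t := by
  have h1 : i t * Phi i f t ≤ ∫⁻ s in Ioo 0 t, Tp i f s := by
    calc i t * Phi i f t = ∫⁻ _ in Ioo 0 t, Tp i f t := by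
          rw [setLIntegral_const, Real.volume_Ioo, sub_zero]; unfold Tp
          rw [ENNReal.div_eq_inv_mul]
          calc _ = ((ENNReal.ofReal t)⁻¹ * ENNReal.ofReal t) * (i t * Phi i f t) := by
                rw [ENNReal.inv_mul_cancel (of_ne ht) ENNReal.ofReal_ne_top, one_mul]
            _ = _ := by ring
      _ ≤ _ := setLIntegral_mono' measurableSet_Ioo fun s hs => Tp_anti h f ⟨hs.1, hs.2.trans ht.2⟩ ht hs.2.le
  calc Phi i f t = (i t)⁻¹ * (i t * Phi i f t) := by
        rw [← mul_assoc, ENNReal.inv_mul_cancel (h.pos t) (h.fin t), one_mul]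
    _ ≤ _ := by unfold Rop; gcongr

def Nop (i g : ℝ → ℝ≥0∞) (t : ℝ) : ℝ≥0∞ := ⨆ s ∈ Ico t 1, Rop i (Tp i g) s

theorem Nop_anti (i f : ℝ → ℝ≥0∞) : Antitone (Nop i f) := fun _ _ h =>
  biSup_mono fun _ hs => ⟨h.trans hs.1, hs.2⟩
theorem Nop_meas (i f : ℝ → ℝ≥0∞) : Measurable (Nop i f) := (Nop_anti i f).measurable

theorem RT_le_Nop (f : ℝ → ℝ≥0∞) {t : ℝ} (ht : t ∈ Ioo (0:ℝ) 1) : Rop i (Tp i f) t ≤ Nop i f t :=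
  le_iSup₂_of_le (f := fun s (_ : s ∈ Ico t 1) => Rop i (Tp i f) s) t ⟨le_rfl, ht.2⟩ le_rfl

theorem Nop_le (h : Adm i C) (f : ℝ → ℝ≥0∞) {t : ℝ} (ht : t ∈ Ioo (0:ℝ) 1) :
    Nop i f t ≤ (1 + C) * Rop i (Tp i f) t := by
  refine iSup₂_le fun s hs => ?_
  have hs' : s ∈ Ioo (0:ℝ) 1 := ⟨ht.1.trans_le hs.1, hs.2⟩
  have hq : Measurable (fun s => i s / ENNReal.ofReal s) := h.meas.div ENNReal.measurable_ofReal
  have h1 : ∫⁻ r in Ioo 0 s, Tp i f r ≤ (∫⁻ r in Ioo 0 t, Tp i f r) + C * i s * Phi i f t := by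
    calc ∫⁻ r in Ioo 0 s, Tp i f r ≤ ∫⁻ r in Ioo 0 t ∪ Ico t s, Tp i f r :=
          lintegral_mono_set fun r hr => by
            rcases lt_or_ge r t with h | h
            · exact Or.inl ⟨hr.1, h⟩
            · exact Or.inr ⟨h, hr.2⟩
      _ ≤ (∫⁻ r in Ioo 0 t, Tp i f r) + ∫⁻ r in Ico t s, Tp i f r := lintegral_union_le _ _ _
      _ ≤ _ := by
          gcongr
          calc ∫⁻ r in Ico t s, Tp i f r ≤ ∫⁻ r in Ico t s, (i r / ENNReal.ofReal r) * Phi i f t := by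
                refine setLIntegral_mono' measurableSet_Ico fun r hr => ?_
                unfold Tp; gcongr; exact Phi_anti i f hr.1
            _ = (∫⁻ r in Ico t s, (i r / ENNReal.ofReal r)) * Phi i f t := lintegral_mul_const _ hq
            _ ≤ _ := by
                gcongr
                exact (lintegral_mono_set (show Ico t s ⊆ Ioo 0 s from fun r hr => ⟨ht.1.trans_le hr.1, hr.2⟩)).trans (h.star s hs')
  calc Rop i (Tp i f) s ≤ (i s)⁻¹ * ((∫⁻ r in Ioo 0 t, Tp i f r) + C * i s * Phi i f t) := by
        unfold Rop; gcongr
    _ = (i s)⁻¹ * (∫⁻ r in Ioo 0 t, Tp i f r) + ((i s)⁻¹ * i s) * (C * Phi i f t) := by ring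
    _ ≤ (i t)⁻¹ * (∫⁻ r in Ioo 0 t, Tp i f r) + 1 * (C * Rop i (Tp i f) t) := by
        rw [ENNReal.inv_mul_cancel (h.pos s) (h.fin s)]
        gcongr
        · exact h.mono ht hs' hs.1
        · exact Phi_le_RT h f ht
    _ = _ := by unfold Rop; ring

theorem Hop_le_one (h : Adm i C) : ∃ K : ℝ≥0∞, K ≠ ⊤ ∧ ∫⁻ s, (i s)⁻¹ ∂mu01 ≤ K := by
  have hh : (1/2:ℝ) ∈ Ioo (0:ℝ) 1 := by norm_num
  refine ⟨C * (ENNReal.ofReal (1/2) / i (1/2)) + (i (1/2))⁻¹ * ENNReal.ofReal (1/2), ?_, ?_⟩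
  · have := ENNReal.inv_ne_top.2 (h.pos (1/2))
    have h2 := ENNReal.div_ne_top (ENNReal.ofReal_ne_top (r := 1/2)) (h.pos (1/2))
    exact ENNReal.add_ne_top.2 ⟨ENNReal.mul_ne_top h.CT h2, ENNReal.mul_ne_top this ENNReal.ofReal_ne_top⟩
  calc ∫⁻ s, (i s)⁻¹ ∂mu01 ≤ ∫⁻ s in Ioo 0 (1/2) ∪ Ico (1/2) 1, (i s)⁻¹ :=
          lintegral_mono_set fun r hr => by
            rcases lt_or_ge r (1/2) with h | h
            · exact Or.inl ⟨hr.1, h⟩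
            · exact Or.inr ⟨h, hr.2⟩
    _ ≤ (∫⁻ s in Ioo 0 (1/2), (i s)⁻¹) + ∫⁻ s in Ico (1/2) 1, (i s)⁻¹ := lintegral_union_le _ _ _
    _ ≤ _ := by
        gcongr
        · exact h.avg _ hh
        · calc ∫⁻ s in Ico (1/2) 1, (i s)⁻¹ ≤ ∫⁻ s in Ico (1/2:ℝ) 1, (i (1/2))⁻¹ := by
                refine setLIntegral_mono' measurableSet_Ico fun r hr => ?_
                gcongr
                exact h.mono hh ⟨hh.1.trans_le hr.1, hr.2⟩ hr.1
            _ = _ := by rw [setLIntegral_const, Real.volume_Ico]; norm_num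

end

theorem chvar {F : ℝ → ℝ≥0∞} (hF : Measurable F) :
    ∫⁻ t, F (t / 3) ∂mu01 ≤ 3 * ∫⁻ t, F t ∂mu01 := by
  have hG : Measurable ((Ioo (0:ℝ) 1).indicator F) := hF.indicator measurableSet_Ioo
  calc ∫⁻ t, F (t / 3) ∂mu01 ≤ ∫⁻ t, ((Ioo (0:ℝ) 1).indicator F) ((3:ℝ)⁻¹ * t) := by
        rw [← lintegral_indicator measurableSet_Ioo]
        refine lintegral_mono fun t => ?_
        by_cases ht : t ∈ Ioo (0:ℝ) 1
        · have : (3:ℝ)⁻¹ * t ∈ Ioo (0:ℝ) 1 := ⟨by linarith [ht.1], by linarith [ht.1, ht.2]⟩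
          rw [indicator_of_mem ht, indicator_of_mem this]
          rw [div_eq_inv_mul]
        · rw [indicator_of_notMem ht]; exact bot_le
    _ = ∫⁻ t, ((Ioo (0:ℝ) 1).indicator F) t ∂(Measure.map (fun x => (3:ℝ)⁻¹ * x) volume) := by
        rw [lintegral_map hG (measurable_const_mul _)]
    _ = 3 * ∫⁻ t, F t ∂mu01 := by
        rw [Real.map_volume_mul_left (by norm_num), lintegral_smul_measure,
          lintegral_indicator measurableSet_Ioo]
        norm_num

section
variable {i : ℝ → ℝ≥0∞} {C : ℝ≥0∞}

theorem Phi_le_rearr (h : Adm i C) (f : ℝ → ℝ≥0∞) {t : ℝ} (ht : t ∈ Ioo (0:ℝ) 1) :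
    Phi i f t ≤ 2 * rearr (Rop i (rearr f)) (t / 3) := by
  refine iSup₂_le fun r hr => ?_
  have hr' : r ∈ Ioo (0:ℝ) 1 := ⟨ht.1.trans_le hr.1, hr.2⟩
  have e : ENNReal.ofReal r = 2 * ENNReal.ofReal (r / 2) := by
    rw [← ENNReal.ofReal_ofNat, ← ENNReal.ofReal_mul (by norm_num)]; congr 1; ring
  rw [e, mul_div_assoc, mul_assoc]
  refine mul_le_mul_right ?_ _
  by_contra hlt
  rw [not_le] at hlt
  have h1 := (rearr_le_iff (Rop i (rearr f)) (t / 3) _).1 le_rfl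
  have h2 : Ioo (r/2) r ⊆ {s ∈ Ioo (0:ℝ) 1 | rearr (Rop i (rearr f)) (t / 3) < Rop i (rearr f) s} := by
    intro s hs
    have hs' : s ∈ Ioo (0:ℝ) 1 := ⟨by linarith [hs.1, hr'.1], hs.2.trans hr'.2⟩
    refine ⟨hs', hlt.trans_le ?_⟩
    calc ENNReal.ofReal (r / 2) / i r * rearr f r = (i r)⁻¹ * (rearr f r * ENNReal.ofReal (r / 2)) := by
          rw [ENNReal.div_eq_inv_mul]; ring
      _ ≤ (i s)⁻¹ * ∫⁻ x in Ioo 0 s, rearr f x := by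
          gcongr
          · exact h.mono hs' hr' hs.2.le
          · calc rearr f r * ENNReal.ofReal (r / 2) ≤ ∫⁻ _ in Ioo 0 s, rearr f r := by
                  rw [setLIntegral_const, Real.volume_Ioo, sub_zero]; gcongr; exact hs.1.le
              _ ≤ _ := setLIntegral_mono' measurableSet_Ioo fun x hx => rearr_antitone f (hx.2.trans hs.2).le
  have h3 := (measure_mono (μ := volume) h2).trans h1
  rw [Real.volume_Ioo, ENNReal.ofReal_le_ofReal_iff (by linarith [ht.1])] at h3
  linarith [hr.1, ht.1]

theorem Phi_core (h : Adm i C) {f u : ℝ → ℝ≥0∞} (hu : Measurable u) :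
    ∃ u', Measurable u' ∧ rearr u' = rearr u ∧
      ∫⁻ t, u t * Phi i f t ∂mu01 ≤ 6 * ∫⁻ t, u' t * Rop i (rearr f) t ∂mu01 := by
  have hR := Rop_meas h (rearr f)
  obtain ⟨u', hu', hru, hle⟩ := resonance hR (rearr_meas u)
  refine ⟨u', hu', by rw [hru, rearr_rearr], ?_⟩
  calc ∫⁻ t, u t * Phi i f t ∂mu01 = ∫⁻ t, Phi i f t * u t ∂mu01 := by simp_rw [mul_comm]
    _ ≤ ∫⁻ t, Phi i f t * rearr u t ∂mu01 := hl_left (Phi_meas i f) ((Phi_anti i f).antitoneOn _) hu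
    _ ≤ ∫⁻ t, 2 * (rearr (Rop i (rearr f)) (t/3) * rearr u (t/3)) ∂mu01 := by
        refine setLIntegral_mono' measurableSet_Ioo fun t ht => ?_
        rw [← mul_assoc]
        gcongr
        · exact Phi_le_rearr h f ht
        · exact rearr_antitone u (by linarith [ht.1])
    _ = 2 * ∫⁻ t, (rearr (Rop i (rearr f)) (t/3) * rearr u (t/3)) ∂mu01 :=
        lintegral_const_mul _ (((rearr_meas _).comp (measurable_id.div_const 3)).mul
          ((rearr_meas _).comp (measurable_id.div_const 3)))
    _ ≤ 2 * (3 * ∫⁻ t, (rearr (Rop i (rearr f)) t * rearr u t) ∂mu01) := by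
        gcongr
        exact chvar (F := fun t => rearr (Rop i (rearr f)) t * rearr u t) ((rearr_meas _).mul (rearr_meas _))
    _ ≤ 2 * (3 * ∫⁻ t, Rop i (rearr f) t * u' t ∂mu01) := by gcongr
    _ = _ := by simp_rw [mul_comm (u' _)]; rw [← mul_assoc]; norm_num

theorem T_core (h : Adm i C) {f u : ℝ → ℝ≥0∞} (hu : Measurable u) :
    ∃ u', Measurable u' ∧ rearr u' = rearr u ∧
      ∫⁻ t, Hop i u t * Tp i f t ∂mu01 ≤ (1 + C) * (∫⁻ t, Hop i u t * rearr f t ∂mu01)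
        + C * (6 * ∫⁻ t, Hop i u' t * rearr f t ∂mu01) := by
  obtain ⟨u', hu', hru, hle⟩ := Phi_core h (f := f) hu
  refine ⟨u', hu', hru, ?_⟩
  rw [duality h hu (Tp_meas h f), duality h hu (rearr_meas f), duality h hu' (rearr_meas f)]
  have hR := Rop_meas h (rearr f)
  calc ∫⁻ t, u t * Rop i (Tp i f) t ∂mu01
      ≤ ∫⁻ t, ((1 + C) * (u t * Rop i (rearr f) t) + C * (u t * Phi i f t)) ∂mu01 := by
        refine setLIntegral_mono' measurableSet_Ioo fun t ht => ?_
        calc u t * Rop i (Tp i f) t ≤ u t * ((1 + C) * Rop i (rearr f) t + C * Phi i f t) := by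
              gcongr; exact RT_le h f ht
          _ = _ := by ring
    _ = (1 + C) * (∫⁻ t, (u t * Rop i (rearr f) t) ∂mu01) + C * ∫⁻ t, (u t * Phi i f t) ∂mu01 := by
        have m1 : Measurable (fun t => u t * Rop i (rearr f) t) := hu.mul hR
        have m2 : Measurable (fun t => u t * Phi i f t) := hu.mul (Phi_meas i f)
        rw [lintegral_add_left (m1.const_mul _), lintegral_const_mul _ m1,
          lintegral_const_mul _ m2]
    _ ≤ _ := by gcongr

end

theorem int_ne_zero {f : ℝ → ℝ≥0∞} (hf : Measurable f) (h : ∀ t ∈ Ioo (0:ℝ) 1, f t ≠ 0) :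
    ∫⁻ t, f t ∂mu01 ≠ 0 := by
  intro h0
  rw [lintegral_eq_zero_iff hf] at h0
  have h1 : ∀ᵐ t ∂mu01, t ∈ Ioo (0:ℝ) 1 := ae_restrict_mem measurableSet_Ioo
  have h2 : ∀ᵐ t ∂mu01, False := by
    filter_upwards [h0, h1] with t a b using h t b a
  rw [ae_iff] at h2
  simp at h2

theorem IsRiNorm.normed_one {ρ} (h : IsRiNorm ρ) : ρ (fun _ => (ρ (fun _ => 1))⁻¹) ≤ 1 := by
  have := h.smul' (f := fun _ => 1) measurable_const (a := (ρ (fun _ => 1))⁻¹) (ENNReal.inv_ne_top.2 h.one_pos)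
  simp only [mul_one] at this
  rw [this, ENNReal.inv_mul_cancel h.one_pos h.one_lt.ne]

theorem assoc_le {ρ : (ℝ → ℝ≥0∞) → ℝ≥0∞} {k : ℝ → ℝ≥0∞} {M : ℝ≥0∞}
    (h : ∀ g, Measurable g → ρ g ≤ 1 → ∫⁻ t, k t * g t ∂mu01 ≤ M) : assoc ρ k ≤ M :=
  iSup₂_le fun g hg => h g hg.1 hg.2

section
variable {i : ℝ → ℝ≥0∞} {C : ℝ≥0∞}

theorem forward (h : Adm i C) {ρX ρY : (ℝ → ℝ≥0∞) → ℝ≥0∞} (hX : IsRiNorm ρX) (hY : IsRiNorm ρY)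
    {C1 : ℝ} (hb : ∀ f, Measurable f → ρY (Hop i f) ≤ ENNReal.ofReal C1 * ρX f)
    (hopt : ∀ ρZ, IsRiNorm ρZ → (∀ f, Measurable f → ρZ (Hop i f) ≤ ρX f) →
      ∃ C2 : ℝ, 0 < C2 ∧ ∀ f, Measurable f → ρZ f ≤ ENNReal.ofReal C2 * ρY f) :
    ∃ K : ℝ≥0∞, K ≠ ⊤ ∧ ∀ f, Measurable f → assoc ρY (Tp i f) ≤ K * assoc ρY f := by
  set W : Set (ℝ → ℝ≥0∞) := {w | ∃ u, Measurable u ∧ ρX u ≤ 1 ∧ w = Hop i u} with hW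
  have hHone : ∀ u, Measurable u → ∫⁻ t, Hop i u t ∂mu01 = ∫⁻ t, u t * Rop i (fun _ => 1) t ∂mu01 := by
    intro u hu
    rw [← duality h hu measurable_const]; simp
  have hRone : ∀ t, Rop i (fun _ => 1) t = (i t)⁻¹ * ENNReal.ofReal t := by
    intro t; simp [Rop]
  obtain ⟨cX, hcX, hX1⟩ := hX.l1
  have hν : IsRiNorm (Lam W) := by
    refine lam_isRi (K := ENNReal.ofReal cX) ?_ ?_ ENNReal.ofReal_ne_top ?_
      (w0 := Hop i (fun _ => (ρX (fun _ => 1))⁻¹)) ⟨_, measurable_const, hX.normed_one, rfl⟩ ?_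
    · rintro w ⟨u, hu, -, rfl⟩; exact Hop_meas i u
    · rintro w ⟨u, hu, -, rfl⟩; exact (Hop_anti i u).antitoneOn _
    · rintro w ⟨u, hu, hu1, rfl⟩
      rw [hHone u hu]
      calc ∫⁻ t, u t * Rop i (fun _ => 1) t ∂mu01 ≤ ∫⁻ t, u t ∂mu01 := by
            refine setLIntegral_mono' measurableSet_Ioo fun t ht => ?_
            refine mul_le_of_le_one_right' ?_
            rw [hRone, ← ENNReal.div_eq_inv_mul]
            exact ENNReal.div_le_of_le_mul (by rw [one_mul]; exact h.low t ht)
        _ ≤ ENNReal.ofReal cX * ρX u := hX1 u hu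
        _ ≤ _ := mul_le_of_le_one_right' hu1
    · rw [hHone _ measurable_const]
      refine int_ne_zero (measurable_const.mul (Rop_meas h _)) fun t ht => ?_
      rw [hRone]
      exact mul_ne_zero (ENNReal.inv_ne_zero.2 hX.one_lt.ne)
        (mul_ne_zero (ENNReal.inv_ne_zero.2 (h.fin t)) (of_ne ht))
  set ν := Lam W with hνd
  set W' : Set (ℝ → ℝ≥0∞) := {w | ∃ g, Measurable g ∧ ν g ≤ 1 ∧ w = rearr g} with hW'
  obtain ⟨cν, hcν, hν1⟩ := hν.l1
  have hZ : IsRiNorm (Lam W') := by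
    refine lam_isRi (K := ENNReal.ofReal cν) ?_ ?_ ENNReal.ofReal_ne_top ?_
      (w0 := rearr (fun _ => (ν (fun _ => 1))⁻¹)) ⟨_, measurable_const, hν.normed_one, rfl⟩ ?_
    · rintro w ⟨g, hg, -, rfl⟩; exact rearr_meas g
    · rintro w ⟨g, hg, -, rfl⟩; exact (rearr_antitone g).antitoneOn _
    · rintro w ⟨g, hg, hg1, rfl⟩
      rw [int_rearr hg]
      exact (hν1 g hg).trans (mul_le_of_le_one_right' hg1)
    · rw [int_rearr measurable_const]
      exact int_ne_zero measurable_const fun t ht => ENNReal.inv_ne_zero.2 hν.one_lt.ne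
  obtain ⟨C2, hC2, hZY⟩ := hopt (Lam W') hZ (by
    intro f hf
    by_cases hfT : ρX f = ⊤
    · rw [hfT]; exact le_top
    refine iSup₂_le ?_
    rintro w ⟨g, hg, hg1, rfl⟩
    calc ∫⁻ t, rearr (Hop i f) t * rearr g t ∂mu01 ≤ ∫⁻ t, Hop i f t * rearr g t ∂mu01 := by
          refine setLIntegral_mono' measurableSet_Ioo fun t ht => ?_
          gcongr; exact rearr_le_self ((Hop_anti i f).antitoneOn _) ht
      _ = ∫⁻ t, Rop i (rearr g) t * f t ∂mu01 := by
          rw [duality h hf (rearr_meas g)]; simp_rw [mul_comm]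
      _ ≤ ρX f * assoc ρX (Rop i (rearr g)) := holder hX hf hfT
      _ ≤ ρX f * 1 := by
          gcongr
          refine assoc_le fun u hu hu1 => ?_
          refine le_trans ?_ hg1
          refine le_trans (le_of_eq ?_) (lam_le (W := W) ⟨u, hu, hu1, rfl⟩ g)
          simp_rw [mul_comm (Rop i _ _), mul_comm (rearr g _)]
          rw [duality h hu (rearr_meas g)]
      _ = _ := mul_one _)
  have hA : ∀ k, Measurable k → assoc ρY k ≤ ENNReal.ofReal C2 * ν k := by
    intro k hk
    by_cases hkT : ν k = ⊤
    · rw [hkT, ENNReal.mul_top (by simpa using hC2)]; exact le_top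
    refine assoc_le fun g hg hg1 => ?_
    calc ∫⁻ t, k t * g t ∂mu01 ≤ ∫⁻ t, rearr k t * rearr g t ∂mu01 := hardy_littlewood hk hg
      _ = ∫⁻ t, rearr g t * rearr k t ∂mu01 := by simp_rw [mul_comm]
      _ ≤ ν (rearr k) * assoc ν (rearr g) := holder hν (rearr_meas k) (by rwa [← hν.ri hk])
      _ ≤ ν k * ENNReal.ofReal C2 := by
          rw [← hν.ri hk]
          gcongr
          refine assoc_le fun v hv hv1 => ?_
          calc ∫⁻ t, rearr g t * v t ∂mu01 ≤ ∫⁻ t, rearr g t * rearr v t ∂mu01 :=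
                hl_left (rearr_meas g) ((rearr_antitone g).antitoneOn _) hv
            _ ≤ Lam W' g := lam_le (W := W') ⟨v, hv, hv1, rfl⟩ g
            _ ≤ ENNReal.ofReal C2 * ρY g := hZY g hg
            _ ≤ _ := mul_le_of_le_one_right' hg1
      _ = _ := mul_comm _ _
  have hB : ∀ f, Measurable f → ν (Tp i f) ≤ ((1 + C) + C * 6) * ν f := by
    intro f hf
    refine iSup₂_le ?_
    rintro w ⟨u, hu, hu1, rfl⟩
    obtain ⟨u', hu', hru, hle⟩ := T_core h (f := f) hu
    have e : ∀ u, Measurable u → ρX u ≤ 1 → ∫⁻ t, Hop i u t * rearr f t ∂mu01 ≤ ν f := by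
      intro u hu hu1
      refine le_trans (le_of_eq ?_) (lam_le (W := W) ⟨u, hu, hu1, rfl⟩ f)
      simp_rw [mul_comm]
    calc ∫⁻ t, rearr (Tp i f) t * Hop i u t ∂mu01 ≤ ∫⁻ t, Hop i u t * Tp i f t ∂mu01 := by
          refine setLIntegral_mono' measurableSet_Ioo fun t ht => ?_
          rw [mul_comm]
          gcongr; exact rearr_le_self (Tp_anti h f) ht
      _ ≤ _ := hle
      _ ≤ (1 + C) * ν f + C * (6 * ν f) := by
          gcongr
          · exact e u hu hu1
          · exact e u' hu' (by rwa [hX.eq_of_rearr hu' hu hru])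
      _ = _ := by ring
  have hD : ∀ f, Measurable f → ν f ≤ ENNReal.ofReal C1 * assoc ρY f := by
    intro f hf
    refine iSup₂_le ?_
    rintro w ⟨u, hu, hu1, rfl⟩
    obtain ⟨w', hw', hrw, hle⟩ := resonance hf (Hop_meas i u)
    have h1 : ρY w' ≤ ENNReal.ofReal C1 := by
      rw [hY.eq_of_rearr hw' (Hop_meas i u) hrw]
      exact (hb u hu).trans (mul_le_of_le_one_right' hu1)
    exact hle.trans ((holder hY hw' (ne_top_of_le_ne_top ENNReal.ofReal_ne_top h1)).trans (by gcongr))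
  refine ⟨ENNReal.ofReal C2 * (((1 + C) + C * 6) * ENNReal.ofReal C1), ?_, fun f hf => ?_⟩
  · have := h.CT
    finiteness
  · calc assoc ρY (Tp i f) ≤ ENNReal.ofReal C2 * ν (Tp i f) := hA _ (Tp_meas h f)
      _ ≤ ENNReal.ofReal C2 * (((1 + C) + C * 6) * (ENNReal.ofReal C1 * assoc ρY f)) := by
          gcongr
          exact (hB f hf).trans (by gcongr; exact hD f hf)
      _ = _ := by ring

end

section
variable {i : ℝ → ℝ≥0∞} {C : ℝ≥0∞}

theorem HN (h : Adm i C) {f g : ℝ → ℝ≥0∞} (hf : Measurable f) (hg : Measurable g) :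
    ∫⁻ t, Hop i f t * g t ∂mu01 ≤ ∫⁻ t, rearr f t * Nop i g t ∂mu01 := by
  calc ∫⁻ t, Hop i f t * g t ∂mu01 ≤ ∫⁻ t, Hop i f t * rearr g t ∂mu01 :=
        hl_left (Hop_meas i f) ((Hop_anti i f).antitoneOn _) hg
    _ ≤ ∫⁻ t, Hop i f t * Tp i g t ∂mu01 := by
        refine setLIntegral_mono' measurableSet_Ioo fun t ht => ?_
        gcongr; exact rearr_le_Tp h g ht
    _ = ∫⁻ t, f t * Rop i (Tp i g) t ∂mu01 := duality h hf (Tp_meas h g)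
    _ ≤ ∫⁻ t, Nop i g t * f t ∂mu01 := by
        refine setLIntegral_mono' measurableSet_Ioo fun t ht => ?_
        rw [mul_comm]
        gcongr; exact RT_le_Nop g ht
    _ ≤ ∫⁻ t, Nop i g t * rearr f t ∂mu01 :=
        hl_left (Nop_meas i g) ((Nop_anti i g).antitoneOn _) hf
    _ = _ := by simp_rw [mul_comm]

theorem domain_bound (h : Adm i C) {ρY : (ℝ → ℝ≥0∞) → ℝ≥0∞} (hY : IsRiNorm ρY) {K : ℝ≥0∞}
    (hT : ∀ f, Measurable f → assoc ρY (Tp i f) ≤ K * assoc ρY f) {f k : ℝ → ℝ≥0∞}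
    (hk : Measurable k) (hkf : ∀ t ∈ Ioo (0:ℝ) 1, rearr k t = rearr f t) :
    ρY (Hop i k) ≤ ((1 + C) * (K + 1)) * ρY (Hop i (rearr f)) := by
  by_cases hTop : ρY (Hop i (rearr f)) = ⊤
  · rw [hTop, ENNReal.mul_top (by simp)]; exact le_top
  refine lorentz_luxemburg hY (Hop_meas i k) fun g hg hg1 => ?_
  have m1 : Measurable (fun t => rearr f t * Rop i (Tp i g) t) := (rearr_meas f).mul (Rop_meas h _)
  calc ∫⁻ t, Hop i k t * g t ∂mu01 ≤ ∫⁻ t, rearr k t * Nop i g t ∂mu01 := HN h hk hg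
    _ ≤ ∫⁻ t, (1 + C) * (rearr f t * Rop i (Tp i g) t) ∂mu01 := by
        refine setLIntegral_mono' measurableSet_Ioo fun t ht => ?_
        rw [hkf t ht]
        calc _ ≤ rearr f t * ((1 + C) * Rop i (Tp i g) t) := by gcongr; exact Nop_le h g ht
          _ = _ := by ring
    _ = (1 + C) * ∫⁻ t, Tp i g t * Hop i (rearr f) t ∂mu01 := by
        rw [lintegral_const_mul _ m1, ← duality h (rearr_meas f) (Tp_meas h g)]; simp_rw [mul_comm]
    _ ≤ (1 + C) * (ρY (Hop i (rearr f)) * (K + 1)) := by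
        gcongr
        refine (holder hY (Hop_meas i _) hTop).trans ?_
        gcongr
        calc _ ≤ K * assoc ρY g := hT g hg
          _ ≤ K := mul_le_of_le_one_right' hg1
          _ ≤ _ := le_self_add
    _ = _ := by ring

def afun (f : ℝ → ℝ≥0∞) (l : ℝ) : ℝ :=
  min (volume {s ∈ Ioo (0:ℝ) 1 | ENNReal.ofReal l < f s}).toReal (1/2)

theorem dist_fin (f : ℝ → ℝ≥0∞) (l : ℝ≥0∞) : volume {s ∈ Ioo (0:ℝ) 1 | l < f s} ≠ ⊤ :=
  ne_top_of_le_ne_top ENNReal.one_ne_top (dist_le_one f l)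

theorem afun_meas (f : ℝ → ℝ≥0∞) : Measurable (afun f) := by
  refine Antitone.measurable fun l m hlm => ?_
  refine min_le_min ?_ le_rfl
  refine ENNReal.toReal_mono (dist_fin _ _) (measure_mono fun s hs => ⟨hs.1, lt_of_le_of_lt ?_ hs.2⟩)
  exact ENNReal.ofReal_le_ofReal hlm

theorem afun_le (f : ℝ → ℝ≥0∞) (l : ℝ) : afun f l ≤ 1/2 := min_le_right _ _

theorem lt_rearr_of_lt_afun {f : ℝ → ℝ≥0∞} {l t : ℝ} (h0 : 0 ≤ t) (h : t < afun f l) :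
    ENNReal.ofReal l < rearr f t := by
  rw [lt_rearr_iff, ENNReal.ofReal_lt_iff_lt_toReal h0 (dist_fin _ _)]
  exact h.trans_le (min_le_left _ _)

theorem lt_afun {f : ℝ → ℝ≥0∞} {l t : ℝ} (h0 : 0 ≤ t) (ht : t < 1/2) (h : ENNReal.ofReal l < rearr f t) :
    t < afun f l := by
  rw [lt_rearr_iff, ENNReal.ofReal_lt_iff_lt_toReal h0 (dist_fin _ _)] at h
  exact lt_min h ht

def kern (i f : ℝ → ℝ≥0∞) (l x : ℝ) : ℝ≥0∞ :=
  if afun f l < x ∧ x < 2 * afun f l then i (afun f l) / ENNReal.ofReal (afun f l) else 0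

theorem kern_meas (h : Adm i C) (f : ℝ → ℝ≥0∞) : Measurable (fun p : ℝ × ℝ => kern i f p.1 p.2) := by
  have ha : Measurable (fun p : ℝ × ℝ => afun f p.1) := (afun_meas f).comp measurable_fst
  refine Measurable.ite ((measurableSet_lt ha measurable_snd).inter
    (measurableSet_lt measurable_snd (ha.const_mul 2))) ?_ measurable_const
  exact (h.meas.comp ha).div (ENNReal.measurable_ofReal.comp ha)

def ufun (i f : ℝ → ℝ≥0∞) (x : ℝ) : ℝ≥0∞ := ∫⁻ l in Ioi (0:ℝ), kern i f l x

theorem ufun_meas (h : Adm i C) (f : ℝ → ℝ≥0∞) : Measurable (ufun i f) :=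
  Measurable.lintegral_prod_left' (kern_meas h f)

theorem kern_int (f : ℝ → ℝ≥0∞) (l : ℝ) (μ : Measure ℝ) (w : ℝ → ℝ≥0∞) (hw : Measurable w) :
    ∫⁻ x, kern i f l x * w x ∂μ = (i (afun f l) / ENNReal.ofReal (afun f l)) *
      ∫⁻ x in Ioo (afun f l) (2 * afun f l), w x ∂μ := by
  rw [← lintegral_const_mul _ hw, ← lintegral_indicator measurableSet_Ioo]
  refine lintegral_congr fun x => ?_
  by_cases hx : x ∈ Ioo (afun f l) (2 * afun f l)
  · rw [indicator_of_mem hx, kern, if_pos (show _ ∧ _ from hx)]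
  · rw [indicator_of_notMem hx, kern, if_neg (show ¬ (_ ∧ _) from hx), zero_mul]

theorem gen_swap {k : ℝ → ℝ → ℝ≥0∞} (hk : Measurable (fun p : ℝ × ℝ => k p.1 p.2)) (μ : Measure ℝ) [SFinite μ]
    {w : ℝ → ℝ≥0∞} (hw : Measurable w) :
    ∫⁻ x, (∫⁻ l in Ioi (0:ℝ), k l x) * w x ∂μ = ∫⁻ l in Ioi (0:ℝ), ∫⁻ x, k l x * w x ∂μ := by
  have e1 : Measurable (fun p : ℝ × ℝ => k p.2 p.1) := hk.comp measurable_swap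
  have mF : Measurable (fun p : ℝ × ℝ => k p.2 p.1 * w p.1) := e1.mul (hw.comp measurable_fst)
  have mk : ∀ x, Measurable (fun l => k l x) := fun x => hk.comp measurable_prodMk_right
  have hsw := lintegral_lintegral_swap (μ := μ) (ν := volume.restrict (Ioi (0:ℝ)))
    (f := fun x l => k l x * w x) mF.aemeasurable
  rw [← hsw]
  exact lintegral_congr fun x => (lintegral_mul_const _ (mk x)).symm

theorem ufun_int (h : Adm i C) (f : ℝ → ℝ≥0∞) (μ : Measure ℝ) [SFinite μ] {w : ℝ → ℝ≥0∞} (hw : Measurable w) :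
    ∫⁻ x, ufun i f x * w x ∂μ = ∫⁻ l in Ioi (0:ℝ), (i (afun f l) / ENNReal.ofReal (afun f l)) *
      ∫⁻ x in Ioo (afun f l) (2 * afun f l), w x ∂μ := by
  have hs := gen_swap (k := kern i f) (kern_meas h f) μ hw
  simp only [ufun]
  rw [hs]
  exact lintegral_congr fun l => kern_int f l μ w hw

theorem Hop_ufun (h : Adm i C) (f : ℝ → ℝ≥0∞) {t : ℝ} (h0 : 0 < t) (ht : t < 1/2) :
    rearr f t ≤ 2 * Hop i (ufun i f) t := by
  have e : Hop i (ufun i f) t = ∫⁻ x in Ioo t 1, ufun i f x * (i x)⁻¹ := rfl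
  have mv : Measurable (fun x => (i x)⁻¹) := h.meas.inv
  rw [e, ufun_int h f _ mv]
  rw [← ENNReal.inv_mul_le_iff (by norm_num) (by norm_num)]
  nth_rw 1 [← layer_int (rearr f t)]
  have mi : Measurable (fun l : ℝ => (if ENNReal.ofReal l < rearr f t then 1 else 0 : ℝ≥0∞)) :=
    Measurable.ite (measurableSet_lt ENNReal.measurable_ofReal measurable_const) measurable_const measurable_const
  rw [← lintegral_const_mul _ mi]
  refine lintegral_mono fun l => ?_
  by_cases hl : ENNReal.ofReal l < rearr f t
  swap
  · simp [hl]
  simp only [if_pos hl, mul_one]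
  have hta := lt_afun h0.le ht hl
  have ha2 := afun_le f l
  set a := afun f l with had
  have ha : a ∈ Ioo (0:ℝ) 1 := ⟨h0.trans hta, by linarith⟩
  rw [Measure.restrict_restrict measurableSet_Ioo, inter_eq_left.2 (Ioo_subset_Ioo hta.le (by linarith))]
  calc (2:ℝ≥0∞)⁻¹ = (i a / ENNReal.ofReal a) * ((2 * i a)⁻¹ * ENNReal.ofReal a) := by
        rw [ENNReal.mul_inv (by simp) (by simp), ENNReal.div_eq_inv_mul]
        calc (2:ℝ≥0∞)⁻¹ = 2⁻¹ * ((i a)⁻¹ * i a) * ((ENNReal.ofReal a)⁻¹ * ENNReal.ofReal a) := by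
              rw [ENNReal.inv_mul_cancel (h.pos a) (h.fin a), ENNReal.inv_mul_cancel (of_ne ha) ENNReal.ofReal_ne_top]; simp
          _ = _ := by ring
    _ = (i a / ENNReal.ofReal a) * ∫⁻ _ in Ioo a (2 * a), (2 * i a)⁻¹ := by
        rw [setLIntegral_const, Real.volume_Ioo]; congr 3; ring
    _ ≤ _ := by
        gcongr (i a / ENNReal.ofReal a) * ?_
        refine setLIntegral_mono' measurableSet_Ioo fun s hs => ?_
        have hs' : s ∈ Ioo (0:ℝ) 1 := ⟨ha.1.trans hs.1, by linarith [hs.2]⟩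
        gcongr
        have hq := h.quasi a ha s hs' hs.1.le
        rw [ENNReal.div_le_iff (of_ne hs') ENNReal.ofReal_ne_top] at hq
        calc i s ≤ i a / ENNReal.ofReal a * ENNReal.ofReal s := hq
          _ ≤ i a / ENNReal.ofReal a * (2 * ENNReal.ofReal a) := by
              gcongr
              rw [← ENNReal.ofReal_ofNat, ← ENNReal.ofReal_mul (by norm_num)]
              exact ENNReal.ofReal_le_ofReal hs.2.le
          _ = 2 * i a * ((ENNReal.ofReal a)⁻¹ * ENNReal.ofReal a) := by
              rw [ENNReal.div_eq_inv_mul]; ring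
          _ = _ := by rw [ENNReal.inv_mul_cancel (of_ne ha) ENNReal.ofReal_ne_top, mul_one]

theorem ufun_upper (h : Adm i C) (f g : ℝ → ℝ≥0∞) :
    ∫⁻ t, rearr (ufun i f) t * Nop i g t ∂mu01 ≤ ((1 + C) * C) * ∫⁻ t, rearr f t * Tp i g t ∂mu01 := by
  obtain ⟨w, hw, hrw, hle⟩ := resonance (ufun_meas h f) (Nop_meas i g)
  refine hle.trans ?_
  rw [ufun_int h f mu01 hw, layer_mul (rearr_meas f) (Tp_meas h g)]
  have hc : (1 + C) * C ≠ ⊤ := by have := h.CT; finiteness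
  rw [← lintegral_const_mul' _ _ hc]
  refine lintegral_mono fun l => ?_
  have ha2 := afun_le f l
  have hlt : ∀ t, 0 ≤ t → t < afun f l → ENNReal.ofReal l < rearr f t := fun t => lt_rearr_of_lt_afun
  have ha0 : 0 ≤ afun f l := le_min ENNReal.toReal_nonneg (by norm_num)
  simp only
  set a := afun f l with had
  rcases ha0.eq_or_lt with h0 | h0
  · rw [← h0]; simp
  have ha : a ∈ Ioo (0:ℝ) 1 := ⟨h0, by linarith⟩
  have hmu : mu01 (Ioo a (2 * a)) ≤ ENNReal.ofReal a := by
    refine (Measure.restrict_apply_le _ _).trans ?_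
    rw [Real.volume_Ioo]; apply ENNReal.ofReal_le_ofReal; linarith
  have hsub : Ioo 0 a ⊆ Ioo (0:ℝ) 1 := Ioo_subset_Ioo_right ha.2.le
  calc i a / ENNReal.ofReal a * ∫⁻ x in Ioo a (2 * a), w x ∂mu01
      ≤ i a / ENNReal.ofReal a * ∫⁻ x in Ioo 0 a, rearr w x ∂mu01 := by
        gcongr (i a / ENNReal.ofReal a) * ?_
        refine hl_set hw measurableSet_Ioo measurableSet_Ioo fun x hx hxE => ⟨hx.1, ?_⟩
        exact (ENNReal.ofReal_lt_ofReal_iff h0).1 (hxE.trans_le hmu)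
    _ ≤ i a / ENNReal.ofReal a * ((∫⁻ x in Ioo 0 a, (i x)⁻¹) * ((1 + C) * ∫⁻ x in Ioo 0 a, Tp i g x)) := by
        gcongr (i a / ENNReal.ofReal a) * ?_
        rw [Measure.restrict_restrict measurableSet_Ioo, inter_eq_left.2 hsub,
          ← lintegral_mul_const _ (show Measurable (fun x => (i x)⁻¹) from h.meas.inv)]
        refine setLIntegral_mono' measurableSet_Ioo fun s hs => ?_
        rw [hrw]
        calc rearr (Nop i g) s ≤ Nop i g s := rearr_le_self ((Nop_anti i g).antitoneOn _) (hsub hs)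
          _ ≤ (1 + C) * Rop i (Tp i g) s := Nop_le h g (hsub hs)
          _ ≤ (1 + C) * ((i s)⁻¹ * ∫⁻ x in Ioo 0 a, Tp i g x) := by
              unfold Rop; gcongr; exact hs.2.le
          _ = _ := by ring
    _ ≤ i a / ENNReal.ofReal a * ((C * (ENNReal.ofReal a / i a)) * ((1 + C) * ∫⁻ x in Ioo 0 a, Tp i g x)) := by
        gcongr; exact h.avg a ha
    _ = (i a / ENNReal.ofReal a * (ENNReal.ofReal a / i a)) * ((1 + C) * C * ∫⁻ x in Ioo 0 a, Tp i g x) := by ring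
    _ = (1 + C) * C * ∫⁻ x in Ioo 0 a, Tp i g x := by rw [ratio_one h ha, one_mul]
    _ ≤ _ := by
        gcongr (1 + C) * C * ?_
        rw [Measure.restrict_restrict (measurableSet_lt measurable_const (rearr_meas f))]
        exact lintegral_mono_set fun t ht => ⟨hlt t ht.1.le ht.2, hsub ht⟩

theorem backward (h : Adm i C) {ρY : (ℝ → ℝ≥0∞) → ℝ≥0∞} (hY : IsRiNorm ρY) {K : ℝ≥0∞} (hK : K ≠ ⊤)
    (hT : ∀ f, Measurable f → assoc ρY (Tp i f) ≤ K * assoc ρY f) :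
    ∃ ρX, IsRiNorm ρX ∧ (∀ f, Measurable f → ρY (Hop i f) ≤ ρX f) ∧
      ∀ ρZ, IsRiNorm ρZ → ∀ C4 : ℝ≥0∞, C4 ≠ ⊤ → (∀ f, Measurable f → ρZ (Hop i f) ≤ C4 * ρX f) →
        ∃ M : ℝ≥0∞, M ≠ ⊤ ∧ ∀ f, Measurable f → ρZ f ≤ M * ρY f := by
  set W : Set (ℝ → ℝ≥0∞) := {w | ∃ g, Measurable g ∧ assoc ρY g ≤ 1 ∧ w = Nop i g} with hW
  obtain ⟨c, hc, hY1⟩ := hY.l1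
  obtain ⟨K1, hK1, hK1i⟩ := Hop_le_one h
  have hTK : ∀ g, Measurable g → assoc ρY g ≤ 1 → assoc ρY (Tp i g) ≤ K := fun g hg hg1 =>
    (hT g hg).trans (mul_le_of_le_one_right' hg1)
  have hX : IsRiNorm (Lam W) := by
    refine lam_isRi (K := (1 + C) * (K1 * (ρY (fun _ => 1) * K))) ?_ ?_ ?_ ?_
      (w0 := Nop i (fun _ => ENNReal.ofReal c⁻¹)) ⟨_, measurable_const, ?_, rfl⟩ ?_
    · rintro w ⟨g, hg, -, rfl⟩; exact Nop_meas i g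
    · rintro w ⟨g, hg, -, rfl⟩; exact (Nop_anti i g).antitoneOn _
    · have := h.CT
      have h2 := hY.one_lt.ne
      finiteness
    · rintro w ⟨g, hg, hg1, rfl⟩
      calc ∫⁻ t, Nop i g t ∂mu01 ≤ ∫⁻ t, (1 + C) * Rop i (Tp i g) t ∂mu01 :=
            setLIntegral_mono' measurableSet_Ioo fun t ht => Nop_le h g ht
        _ = (1 + C) * ∫⁻ t, (1:ℝ≥0∞) * Rop i (Tp i g) t ∂mu01 := by
            rw [lintegral_const_mul _ (Rop_meas h _)]; simp_rw [one_mul]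
        _ = (1 + C) * ∫⁻ t, Hop i (fun _ => 1) t * Tp i g t ∂mu01 := by
            rw [duality h measurable_const (Tp_meas h g)]
        _ ≤ (1 + C) * (K1 * ∫⁻ t, Tp i g t * 1 ∂mu01) := by
            simp_rw [mul_one]
            rw [← lintegral_const_mul _ (Tp_meas h g)]
            gcongr (1 + C) * ?_
            refine setLIntegral_mono' measurableSet_Ioo fun t ht => ?_
            gcongr
            refine le_trans ?_ hK1i
            unfold Hop
            simp_rw [one_div]
            exact lintegral_mono_set (Ioo_subset_Ioo_left ht.1.le)
        _ ≤ _ := by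
            gcongr
            refine (holder hY (k := Tp i g) (v := fun _ => 1) measurable_const hY.one_lt.ne).trans ?_
            gcongr
            exact hTK g hg hg1
    · refine assoc_le fun g hg hg1 => ?_
      rw [lintegral_const_mul _ hg]
      calc _ ≤ ENNReal.ofReal c⁻¹ * (ENNReal.ofReal c * 1) := by
            gcongr; exact (hY1 g hg).trans (by gcongr)
        _ = 1 := by
            rw [mul_one, ← ENNReal.ofReal_mul (by positivity), inv_mul_cancel₀ hc.ne', ENNReal.ofReal_one]
    · refine int_ne_zero (Nop_meas i _) fun t ht => ne_of_gt ?_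
      refine lt_of_lt_of_le ?_ (RT_le_Nop _ ht)
      refine lt_of_lt_of_le ?_ (Phi_le_RT h _ ht)
      refine lt_of_lt_of_le ?_ (le_Phi ht _)
      refine ENNReal.mul_pos (ENNReal.div_ne_zero.2 ⟨of_ne ht, h.fin t⟩) (ne_of_gt ?_)
      rw [lt_rearr_iff]
      have : {s ∈ Ioo (0:ℝ) 1 | 0 < ENNReal.ofReal c⁻¹} = Ioo (0:ℝ) 1 := by
        ext s; simp [hc]
      rw [this, Real.volume_Ioo]
      exact (ENNReal.ofReal_lt_ofReal_iff (by norm_num)).2 (by linarith [ht.2])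
  refine ⟨Lam W, hX, fun f hf => lorentz_luxemburg hY (Hop_meas i f) fun g hg hg1 =>
    (HN h hf hg).trans (lam_le (W := W) ⟨g, hg, hg1, rfl⟩ f), ?_⟩
  intro ρZ hZ C4 hC4 hb
  refine ⟨2 * (C4 * ((1 + C) * C * K)) + 2 * ENNReal.ofReal c * ρZ (fun _ => 1) + 1, ?_, fun f hf => ?_⟩
  · have := h.CT
    have h2 := hZ.one_lt.ne
    finiteness
  by_cases hfT : ρY f = ⊤
  · rw [hfT, ENNReal.mul_top (by simp)]; exact le_top
  set b := rearr f (1/2) with hbd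
  have hbb : b ≤ 2 * (ENNReal.ofReal c * ρY f) := by
    rw [← ENNReal.inv_mul_le_iff (by norm_num) (by norm_num)]
    refine le_trans ?_ (hY1 f hf)
    rw [← int_rearr hf]
    calc 2⁻¹ * b = ∫⁻ _ in Ioo (0:ℝ) (1/2), b := by
          rw [setLIntegral_const, Real.volume_Ioo, mul_comm]
          congr 1
          rw [sub_zero, one_div, ENNReal.ofReal_inv_of_pos (by norm_num)]; simp
      _ ≤ ∫⁻ x in Ioo (0:ℝ) (1/2), rearr f x :=
          setLIntegral_mono' measurableSet_Ioo fun x hx => rearr_antitone f hx.2.le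
      _ ≤ _ := lintegral_mono_set (Ioo_subset_Ioo_right (by norm_num))
  have hbT : b ≠ ⊤ := ne_top_of_le_ne_top (by finiteness) hbb
  have hu : Lam W (ufun i f) ≤ ((1 + C) * C * K) * ρY f := by
    refine iSup₂_le ?_
    rintro w ⟨g, hg, hg1, rfl⟩
    refine (ufun_upper h f g).trans ?_
    calc _ = ((1 + C) * C) * ∫⁻ t, Tp i g t * rearr f t ∂mu01 := by simp_rw [mul_comm (rearr f _)]
      _ ≤ ((1 + C) * C) * (ρY f * K) := by
          gcongr
          refine (holder hY (rearr_meas f) (by rwa [← hY.ri hf])).trans ?_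
          rw [← hY.ri hf]
          gcongr
          exact hTK g hg hg1
      _ = _ := by ring
  have m1 : Measurable (fun t => 2 * Hop i (ufun i f) t) := (Hop_meas i _).const_mul 2
  have m2 : Measurable (fun _ : ℝ => b * 1) := measurable_const
  calc ρZ f = ρZ (rearr f) := hZ.ri hf
    _ ≤ ρZ (fun t => 2 * Hop i (ufun i f) t + b * 1) := by
        refine hZ.mono (rearr_meas f) (m1.add m2) ?_
        filter_upwards [ae_restrict_mem measurableSet_Ioo] with t ht
        rcases lt_or_ge t (1/2) with h2 | h2
        · exact le_add_right (Hop_ufun h f ht.1 h2)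
        · rw [mul_one]; exact le_add_left (rearr_antitone f h2)
    _ ≤ ρZ (fun t => 2 * Hop i (ufun i f) t) + ρZ (fun _ => b * 1) := hZ.add m1 m2
    _ = 2 * ρZ (Hop i (ufun i f)) + b * ρZ (fun _ => 1) := by
        rw [hZ.smul' (Hop_meas i _) (by norm_num), hZ.smul' (f := fun _ => 1) measurable_const hbT]
    _ ≤ 2 * (C4 * (((1 + C) * C * K) * ρY f)) + (2 * (ENNReal.ofReal c * ρY f)) * ρZ (fun _ => 1) := by
        gcongr
        exact (hb _ (ufun_meas h f)).trans (by gcongr)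
    _ = (2 * (C4 * ((1 + C) * C * K)) + 2 * ENNReal.ofReal c * ρZ (fun _ => 1)) * ρY f := by ring
    _ ≤ _ := mul_le_mul_left le_self_add _

end

open Classical in
def iof (I : ℝ → ℝ) (s : ℝ) : ℝ≥0∞ := if s ∈ Ioo (0:ℝ) 1 then ENNReal.ofReal (I s) else 1

theorem iof_eq (I : ℝ → ℝ) {s : ℝ} (hs : s ∈ Ioo (0:ℝ) 1) : iof I s = ENNReal.ofReal (I s) := by
  rw [iof, if_pos hs]

open Classical in
theorem adm_iof {I : ℝ → ℝ} (hI : ClassQ I) : ∃ C, Adm (iof I) C := by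
  obtain ⟨⟨hbij, hmono, hanti, -, -⟩, ⟨C1, hC1, hstar⟩, ⟨C2, hC2, havg⟩, -⟩ := hI
  have hmap : ∀ s ∈ Ioo (0:ℝ) 1, I s ∈ Ioo (0:ℝ) 1 := fun s hs => hbij.mapsTo hs
  refine ⟨ENNReal.ofReal (max C1 C2), ?_, ?_, ?_, ?_, ?_, ?_, ?_, ?_, ENNReal.ofReal_ne_top⟩
  · have hJ : Monotone (fun s : ℝ => if s ≤ 0 then 0 else if s < 1 then ENNReal.ofReal (I s) else 1) := by
      intro s t hst
      simp only
      split_ifs with h1 h2 h3 h4 h5 h6 h7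
      any_goals first | exact bot_le | (exfalso; linarith) | exact le_rfl
      · exact ENNReal.ofReal_le_ofReal (hmono ⟨by linarith, by linarith⟩ ⟨by linarith, by linarith⟩ hst)
      · exact ENNReal.ofReal_le_one.2 (hmap s ⟨by linarith, by linarith⟩).2.le
    have : iof I = fun s : ℝ => if s ∈ Ioo (0:ℝ) 1 then (if s ≤ 0 then 0 else if s < 1 then ENNReal.ofReal (I s) else 1) else 1 := by
      ext s
      unfold iof
      split_ifs with h1 h2 h3
      · exact absurd h2 (not_le.2 h1.1)
      · rfl
      · exact absurd h1.2 h3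
      · rfl
    rw [this]
    exact Measurable.ite measurableSet_Ioo hJ.measurable measurable_const
  · intro s
    by_cases hs : s ∈ Ioo (0:ℝ) 1
    · rw [iof_eq I hs]; simpa using (hmap s hs).1
    · simp [iof, hs]
  · intro s
    by_cases hs : s ∈ Ioo (0:ℝ) 1
    · rw [iof_eq I hs]; exact ENNReal.ofReal_ne_top
    · simp [iof, hs]
  · intro s hs t ht hst
    rw [iof_eq I hs, iof_eq I ht]
    exact ENNReal.ofReal_le_ofReal (hmono hs ht hst)
  · intro s hs t ht hst
    rw [iof_eq I hs, iof_eq I ht, ← ENNReal.ofReal_div_of_pos hs.1, ← ENNReal.ofReal_div_of_pos ht.1]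
    exact ENNReal.ofReal_le_ofReal (hanti hs ht hst)
  · intro t ht
    rw [iof_eq I ht]
    calc _ = ∫⁻ s in Ioo 0 t, ENNReal.ofReal (I s / s) := by
          refine setLIntegral_congr_fun measurableSet_Ioo fun s hs => ?_
          rw [iof_eq I ⟨hs.1, hs.2.trans ht.2⟩, ← ENNReal.ofReal_div_of_pos hs.1]
      _ ≤ ENNReal.ofReal (C1 * I t) := hstar t ht
      _ = ENNReal.ofReal C1 * ENNReal.ofReal (I t) := ENNReal.ofReal_mul hC1.le
      _ ≤ _ := by gcongr; exact le_max_left _ _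
  · intro t ht
    rw [iof_eq I ht]
    calc _ = ∫⁻ s in Ioo 0 t, ENNReal.ofReal (1 / I s) := by
          refine setLIntegral_congr_fun measurableSet_Ioo fun s hs => ?_
          have hs' : s ∈ Ioo (0:ℝ) 1 := ⟨hs.1, hs.2.trans ht.2⟩
          rw [iof_eq I hs', one_div, ENNReal.ofReal_inv_of_pos (hmap s hs').1]
      _ ≤ ENNReal.ofReal (C2 * (t / I t)) := havg t ht
      _ = ENNReal.ofReal C2 * (ENNReal.ofReal t / ENNReal.ofReal (I t)) := by
          rw [ENNReal.ofReal_mul hC2.le, ENNReal.ofReal_div_of_pos (hmap t ht).1]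
      _ ≤ _ := by gcongr; exact le_max_right _ _
  · intro t ht
    rw [iof_eq I ht]
    apply ENNReal.ofReal_le_ofReal
    by_contra hlt
    rw [not_le] at hlt
    have hq : I t / t < 1 := (div_lt_one ht.1).2 hlt
    have h0 := (hmap t ht).1
    have hq1 : I t < I t / t := by
      rw [lt_div_iff₀ ht.1]; nlinarith [ht.2]
    obtain ⟨s, hs, hsy⟩ := hbij.surjOn (show (1 + I t / t) / 2 ∈ Ioo (0:ℝ) 1 from ⟨by linarith, by linarith⟩)
    have hts : t ≤ s := by
      by_contra hc
      have := hmono hs ht (not_le.1 hc).le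
      linarith
    have h1 := hanti ht hs hts
    simp only at h1
    have h2 : I s ≤ I s / s := by
      rw [le_div_iff₀ hs.1]; nlinarith [hs.2, (hmap s hs).1]
    linarith

theorem HI_eq (I : ℝ → ℝ) (f : ℝ → ℝ≥0∞) : ∀ t ∈ Ioo (0:ℝ) 1, HI I f t = Hop (iof I) f t := by
  intro t ht
  refine setLIntegral_congr_fun measurableSet_Ioo fun s hs => ?_
  rw [iof_eq I ⟨ht.1.trans hs.1, hs.2⟩]

theorem HI_meas (I : ℝ → ℝ) (f : ℝ → ℝ≥0∞) : Measurable (HI I f) :=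
  (show Antitone (HI I f) from fun _ _ h => lintegral_mono_set (Ioo_subset_Ioo_left h)).measurable

theorem norm_HI {ρ} (h : IsRiNorm ρ) (I : ℝ → ℝ) (f : ℝ → ℝ≥0∞) : ρ (HI I f) = ρ (Hop (iof I) f) :=
  h.congr (HI_meas I f) (Hop_meas _ f) (HI_eq I f)

theorem TI_eq {I : ℝ → ℝ} (hI : ClassQ I) (f : ℝ → ℝ≥0∞) : ∀ t ∈ Ioo (0:ℝ) 1, TI I f t = Tp (iof I) f t := by
  intro t ht
  unfold TI Tp Phi
  rw [ENNReal.ofReal_div_of_pos ht.1, iof_eq I ht]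
  congr 1
  refine iSup_congr fun s => iSup_congr fun hs => ?_
  have hs' : s ∈ Ioo (0:ℝ) 1 := ⟨ht.1.trans_le hs.1, hs.2⟩
  rw [iof_eq I hs', ENNReal.ofReal_div_of_pos (hI.1.1.mapsTo hs').1]

theorem assoc_TI {I : ℝ → ℝ} (hI : ClassQ I) (ρ : (ℝ → ℝ≥0∞) → ℝ≥0∞) (f : ℝ → ℝ≥0∞) :
    assoc ρ (TI I f) = assoc ρ (Tp (iof I) f) := by
  unfold assoc
  refine iSup_congr fun g => iSup_congr fun hg => setLIntegral_congr_fun measurableSet_Ioo fun t ht => ?_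
  rw [TI_eq hI f t ht]

theorem to_real_const {M : ℝ≥0∞} (hM : M ≠ ⊤) : ∃ C : ℝ, 0 < C ∧ M ≤ ENNReal.ofReal C := by
  refine ⟨M.toReal + 1, by positivity, ?_⟩
  rw [← ENNReal.ofReal_toReal hM]
  apply ENNReal.ofReal_le_ofReal
  rw [ENNReal.toReal_ofReal ENNReal.toReal_nonneg]; linarith

theorem forward' {I : ℝ → ℝ} (hI : ClassQ I) {ρY : (ℝ → ℝ≥0∞) → ℝ≥0∞} (hρY : IsRiNorm ρY)
    (hx : ∃ ρX : (ℝ → ℝ≥0∞) → ℝ≥0∞, IsRiNorm ρX ∧ IsOptimalTarget I ρX ρY) :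
    ∃ K : ℝ≥0∞, K ≠ ⊤ ∧ ∀ f, Measurable f → assoc ρY (Tp (iof I) f) ≤ K * assoc ρY f := by
  obtain ⟨C, hA⟩ := adm_iof hI
  obtain ⟨ρX, hX, ⟨C1, hC1, hb⟩, hopt⟩ := hx
  refine forward hA hX hρY (C1 := C1) (fun f hf => ?_) (fun ρZ hZ hZb => ?_)
  · rw [← norm_HI hρY]; exact hb f hf
  · refine hopt ρZ hZ ⟨1, one_pos, fun f hf => ?_⟩
    rw [norm_HI hZ, ENNReal.ofReal_one, one_mul]; exact hZb f hf

/-- second half of Theorem 1.2 / `thm:main`.  Let `I ∈ 𝒬` and let `‖·‖_Y` be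
an r.i. norm.  Then `Y` is the optimal target space under `H_I` for some r.i. space `X` iff
`T_I` is bounded on `Y'`; and in that case the optimal domain norm
`‖f‖_{X_Y} = sup_{h^* = f^*} ‖H_I h‖_Y` satisfies `‖f‖_{X_Y} ≈ ‖∫_t^1 f^*(s)/I(s) ds‖_Y`. -/
theorem statement2 (I : ℝ → ℝ) (hI : ClassQ I)
    (ρY : (ℝ → ℝ≥0∞) → ℝ≥0∞) (hρY : IsRiNorm ρY) :
    ((∃ ρX : (ℝ → ℝ≥0∞) → ℝ≥0∞, IsRiNorm ρX ∧ IsOptimalTarget I ρX ρY) ↔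
      ∃ C : ℝ, 0 < C ∧ ∀ f : ℝ → ℝ≥0∞, Measurable f →
        assoc ρY (TI I f) ≤ ENNReal.ofReal C * assoc ρY f) ∧
    ((∃ ρX : (ℝ → ℝ≥0∞) → ℝ≥0∞, IsRiNorm ρX ∧ IsOptimalTarget I ρX ρY) →
      ∃ c₁ c₂ : ℝ, 0 < c₁ ∧ 0 < c₂ ∧ ∀ f : ℝ → ℝ≥0∞, Measurable f →
        ENNReal.ofReal c₁ * optDomainNorm I ρY f ≤ ρY (HI I (rearr f)) ∧
          ρY (HI I (rearr f)) ≤ ENNReal.ofReal c₂ * optDomainNorm I ρY f) := by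
  obtain ⟨C, hA⟩ := adm_iof hI
  refine ⟨⟨fun hx => ?_, ?_⟩, fun hx => ?_⟩
  · obtain ⟨K, hK, hT⟩ := forward' hI hρY hx
    obtain ⟨C', hC', hKC⟩ := to_real_const hK
    refine ⟨C', hC', fun f hf => ?_⟩
    rw [assoc_TI hI]
    exact (hT f hf).trans (by gcongr)
  · rintro ⟨C', hC', hT⟩
    obtain ⟨ρX, hX, hb, hopt⟩ := backward hA hρY (K := ENNReal.ofReal C') ENNReal.ofReal_ne_top
      (fun f hf => by rw [← assoc_TI hI]; exact hT f hf)
    refine ⟨ρX, hX, ⟨1, one_pos, fun f hf => ?_⟩, ?_⟩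
    · rw [norm_HI hρY, ENNReal.ofReal_one, one_mul]; exact hb f hf
    · rintro ρZ hZ ⟨C4, hC4, hZb⟩
      obtain ⟨M, hM, hMf⟩ := hopt ρZ hZ (ENNReal.ofReal C4) ENNReal.ofReal_ne_top
        (fun f hf => by rw [← norm_HI hZ]; exact hZb f hf)
      obtain ⟨D, hD, hMD⟩ := to_real_const hM
      exact ⟨D, hD, fun f hf => (hMf f hf).trans (by gcongr)⟩
  · obtain ⟨K, hK, hT⟩ := forward' hI hρY hx
    have hM : (1 + C) * (K + 1) ≠ ⊤ := by
      have := hA.CT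
      finiteness
    obtain ⟨D, hD, hMD⟩ := to_real_const hM
    refine ⟨D⁻¹, 1, inv_pos.2 hD, one_pos, fun f hf => ⟨?_, ?_⟩⟩
    · have h1 : optDomainNorm I ρY f ≤ ENNReal.ofReal D * ρY (HI I (rearr f)) := by
        refine iSup₂_le fun k hk => ?_
        rw [norm_HI hρY, norm_HI hρY]
        exact (domain_bound hA hρY hT hk.1 hk.2).trans (by gcongr)
      calc ENNReal.ofReal D⁻¹ * optDomainNorm I ρY f
          ≤ ENNReal.ofReal D⁻¹ * (ENNReal.ofReal D * ρY (HI I (rearr f))) := by gcongr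
        _ = ρY (HI I (rearr f)) := by
            rw [← mul_assoc, ← ENNReal.ofReal_mul (inv_pos.2 hD).le, inv_mul_cancel₀ hD.ne',
              ENNReal.ofReal_one, one_mul]
    · rw [ENNReal.ofReal_one, one_mul]
      exact le_iSup₂_of_le (f := fun (k : ℝ → ℝ≥0∞)
        (_ : Measurable k ∧ ∀ t ∈ Set.Ioo (0:ℝ) 1, rearr k t = rearr f t) => ρY (HI I k))
        (rearr f) ⟨rearr_meas f, fun t _ => by rw [rearr_rearr]⟩ le_rfl
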